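/- arXiv:0705.4341 — 5 statements merged into one kernel-verified Lean document; each statement's English description precedes it below -/
import Mathlib

section
/- Suppose A is a C*-algebra and X₁₁, X₁₂, X₂₁, X₂₂ are closed linear subspaces of A with X_ij* = X_ji, X_ij·X_jk ⊆ X_ik, and X₁₁·X₂₂ = {0}. Then: (a) every x ∈ X_ij factors as x = a y b for some y ∈ A, where a = |x*|^{1/4} ∈ X_ii and b = |x|^{1/4} ∈ X_jj (in particular |x| ∈ X_jj and |x*| ∈ X_ii); (b) X_ij·X_kl = {0} whenever j ≠ k; (c) X_ij ∩ X_kl = {0} whenever (i,j) ≠ (k,l). -/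
open scoped NNReal

section Factorization

variable {A : Type*} [NonUnitalCStarAlgebra A]

/-- The continuous functional calculus is intertwined by `x` between `star x * x` and
`x * star x`. -/
theorem mul_cfcₙ_star_mul_self (x : A) {f : ℝ → ℝ} (hf : Continuous f) :
    x * cfcₙ f (star x * x) = cfcₙ f (x * star x) * x := by
  let S : NonUnitalStarSubalgebra ℝ (A × A) :=
    { carrier := {p | x * p.1 = p.2 * x ∧ p.1 * star x = star x * p.2}
      add_mem' := fun {p q} hp hq ↦ by
        simp [mul_add, add_mul, hp.1, hp.2, hq.1, hq.2]
      zero_mem' := by simp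
      mul_mem' := fun {p q} hp hq ↦ by
        refine ⟨?_, ?_⟩
        · rw [Prod.fst_mul, Prod.snd_mul, ← mul_assoc, hp.1, mul_assoc, hq.1, mul_assoc]
        · rw [Prod.fst_mul, Prod.snd_mul, mul_assoc, hq.2, ← mul_assoc, hp.2, mul_assoc]
      smul_mem' := fun c p hp ↦ by
        simp [mul_smul_comm, smul_mul_assoc, hp.1, hp.2]
      star_mem' := fun {p} hp ↦ by
        refine ⟨?_, ?_⟩
        · simpa using congr(star $(hp.2))
        · simpa using congr(star $(hp.1)) }
  have hS : IsClosed (S : Set (A × A)) :=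
    (isClosed_eq (by fun_prop) (by fun_prop)).inter (isClosed_eq (by fun_prop) (by fun_prop))
  have hmem : (star x * x, x * star x) ∈ S := ⟨by simp [mul_assoc], by simp [mul_assoc]⟩
  have hsa : IsSelfAdjoint (star x * x, x * star x) :=
    Prod.ext (IsSelfAdjoint.star_mul_self x) (IsSelfAdjoint.mul_star_self x)
  have h := cfcₙ_mem (s := S) f hmem
  rw [cfcₙ_map_prod (S := ℝ) f _ _ hf.continuousOn hsa
    (IsSelfAdjoint.star_mul_self x) (IsSelfAdjoint.mul_star_self x)] at h
  exact h.1

variable [PartialOrder A] [StarOrderedRing A]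

theorem norm_smul_sub_mul_cfcₙ_le (x : A) {g : ℝ → ℝ} (hg : Continuous g) (hg0 : g 0 = 0)
    (c : ℝ) {C : ℝ} (hC : 0 ≤ C) (h : ∀ t, 0 ≤ t → t * (c - g t) ^ 2 ≤ C ^ 2) :
    ‖c • x - x * cfcₙ g (star x * x)‖ ≤ C := by
  have hsa : IsSelfAdjoint (star x * x) := .star_mul_self x
  have hG : star (cfcₙ g (star x * x)) = cfcₙ g (star x * x) :=
    IsSelfAdjoint.star_eq (cfcₙ_predicate g _)
  have key : star (c • x - x * cfcₙ g (star x * x)) * (c • x - x * cfcₙ g (star x * x)) =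
      cfcₙ (fun t ↦ t * (c - g t) ^ 2) (star x * x) := by
    have e : (fun t ↦ t * (c - g t) ^ 2) =
        fun t ↦ c * (c * t) - c * (t * g t) - (c * (g t * t) - g t * (t * g t)) := by
      ext t; ring
    rw [e, cfcₙ_sub .., cfcₙ_sub .., cfcₙ_sub .., cfcₙ_const_mul .., cfcₙ_const_mul ..,
      cfcₙ_const_mul .., cfcₙ_const_mul .., cfcₙ_mul .., cfcₙ_mul .., cfcₙ_mul .., cfcₙ_mul ..,
      cfcₙ_id' ..]
    simp only [star_sub, star_smul, star_mul, hG, star_trivial, sub_mul, mul_sub, smul_sub,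
      smul_mul_assoc, mul_smul_comm, mul_assoc]
    abel
  have hn := CStarRing.norm_star_mul_self (x := c • x - x * cfcₙ g (star x * x))
  rw [key] at hn
  refine abs_le_of_sq_le_sq' ?_ hC |>.2
  rw [sq, ← hn]
  refine norm_cfcₙ_le fun t ht ↦ ?_
  have ht0 : 0 ≤ t := quasispectrum_nonneg_of_nonneg _ (star_mul_self_nonneg x) t ht
  rw [Real.norm_of_nonneg (by positivity)]
  exact h t ht0

/-- Every `x` factors as `|x*|^{1/4} y |x|^{1/4}`. -/
theorem exists_eq_nnrpow_mul_mul_nnrpow (x : A) :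
    ∃ y : A, x = CFC.nnrpow (x * star x) (8⁻¹ : ℝ≥0) * y *
      CFC.nnrpow (star x * x) (8⁻¹ : ℝ≥0) := by
  have hk (a : A) (ha : 0 ≤ a) :
      CFC.nnrpow a (8⁻¹ : ℝ≥0) = cfcₙ (fun t : ℝ ↦ t ^ (8⁻¹ : ℝ)) a := by
    simpa using CFC.nnrpow_eq_cfcₙ_real a (8⁻¹ : ℝ≥0) ha
  rw [hk _ (mul_star_self_nonneg x), hk _ (star_mul_self_nonneg x)]
  set k : ℝ → ℝ := fun t ↦ t ^ (8⁻¹ : ℝ) with hkdef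
  have hkc : Continuous k := Real.continuous_rpow_const (by norm_num)
  have hk0 : k 0 = 0 := Real.zero_rpow (by norm_num)
  have hk8 (t : ℝ) (ht : 0 ≤ t) : t = k t ^ 8 := by
    rw [hkdef, ← Real.rpow_natCast, ← Real.rpow_mul ht]; norm_num
  let e : ℕ → ℝ := fun n ↦ 1 / ((n : ℝ) + 1)
  have he (n : ℕ) : 0 < e n := by positivity
  have he0 : Filter.Tendsto e Filter.atTop (nhds 0) := tendsto_one_div_add_atTop_nhds_zero_nat
  let f : ℕ → ℝ → ℝ := fun n t ↦ k t ^ 2 / (k t ^ 4 + e n ^ 2)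
  have hden (n : ℕ) (t : ℝ) : 0 < k t ^ 4 + e n ^ 2 := by have := he n; positivity
  have hfc (n : ℕ) : Continuous (f n) :=
    (hkc.pow 2).div ((hkc.pow 4).add continuous_const) fun t ↦ (hden n t).ne'
  have hf0 (n : ℕ) : f n 0 = 0 := by simp [f, hk0]
  have hcauchy : CauchySeq fun n ↦ x * cfcₙ (f n) (star x * x) := by
    refine cauchySeq_of_le_tendsto_0' e (fun n m hnm ↦ ?_) he0
    rw [dist_eq_norm, ← mul_sub, ← cfcₙ_sub (f n) (f m) (star x * x) (hfc n).continuousOn (hf0 n)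
      (hfc m).continuousOn (hf0 m), ← norm_neg]
    have := norm_smul_sub_mul_cfcₙ_le x (g := fun t ↦ f n t - f m t)
      ((hfc n).sub (hfc m)) (by simp [hf0]) 0 (he n).le
      fun t ht ↦ ?_
    · simpa using this
    have hem : e m ≤ e n := one_div_le_one_div_of_le (by positivity) (by gcongr)
    have hd : f n t - f m t =
        k t ^ 2 * (e m ^ 2 - e n ^ 2) / ((k t ^ 4 + e n ^ 2) * (k t ^ 4 + e m ^ 2)) := by
      have := (hden n t).ne'
      have := (hden m t).ne'
      simp only [f]
      field_simp
      ring
    have h1 : t * (0 - (f n t - f m t)) ^ 2 = (k t ^ 4 * (f n t - f m t)) ^ 2 := by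
      nth_rw 1 [hk8 t ht]; ring
    rw [h1, sq_le_sq, abs_of_pos (he n), hd]
    have hs : 0 ≤ k t ^ 2 := by positivity
    have hen := he n
    have hem' := he m
    rw [← mul_div_assoc, abs_div, abs_of_pos (mul_pos (hden n t) (hden m t)),
      div_le_iff₀ (mul_pos (hden n t) (hden m t)), abs_mul, abs_mul,
      abs_of_nonneg (by positivity : 0 ≤ k t ^ 4), abs_of_nonneg hs]
    have h2 : |e m ^ 2 - e n ^ 2| ≤ e n ^ 2 := by
      rw [abs_le]; constructor <;> nlinarith
    have h3 : k t ^ 2 * e n ≤ k t ^ 4 + e n ^ 2 := by nlinarith [sq_nonneg (k t ^ 2 - e n)]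
    calc k t ^ 4 * (k t ^ 2 * |e m ^ 2 - e n ^ 2|)
        ≤ k t ^ 4 * (k t ^ 2 * e n ^ 2) := by gcongr
      _ = e n * ((k t ^ 2 * e n) * k t ^ 4) := by ring
      _ ≤ e n * ((k t ^ 4 + e n ^ 2) * (k t ^ 4 + e m ^ 2)) := by
          gcongr
          nlinarith
  obtain ⟨y, hy⟩ := cauchySeq_tendsto_of_complete hcauchy
  refine ⟨y, tendsto_nhds_unique ?_ ((hy.const_mul (cfcₙ k (x * star x))).mul_const
    (cfcₙ k (star x * x)))⟩
  have hprod (n : ℕ) : cfcₙ k (x * star x) * (x * cfcₙ (f n) (star x * x)) *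
      cfcₙ k (star x * x) = x * cfcₙ (fun t ↦ k t * f n t * k t) (star x * x) := by
    have hc := (hfc n).continuousOn (s := quasispectrum ℝ (star x * x))
    have hkc' := hkc.continuousOn (s := quasispectrum ℝ (star x * x))
    rw [cfcₙ_mul (fun t ↦ k t * f n t) k _ (hkc'.mul hc) (by simp [hk0]) hkc' hk0,
      cfcₙ_mul k (f n) _ hkc' hk0 hc (hf0 n), ← mul_assoc, ← mul_cfcₙ_star_mul_self x hkc]
    simp only [mul_assoc]
  simp only [hprod]
  rw [tendsto_iff_norm_sub_tendsto_zero]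
  refine squeeze_zero (fun _ ↦ norm_nonneg _) (fun n ↦ ?_)
    (show Filter.Tendsto (fun n ↦ e n ^ 2) Filter.atTop (nhds 0) by simpa using he0.pow 2)
  rw [norm_sub_rev]
  have := norm_smul_sub_mul_cfcₙ_le x (g := fun t ↦ k t * f n t * k t)
    ((hkc.mul (hfc n)).mul hkc) (by simp [hk0]) 1 (sq_nonneg (e n)) fun t ht ↦ ?_
  · simpa using this
  have hd : 1 - k t * f n t * k t = e n ^ 2 / (k t ^ 4 + e n ^ 2) := by
    have := (hden n t).ne'
    simp only [f]
    field_simp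
    ring
  have h1 : t * (1 - k t * f n t * k t) ^ 2 = (k t ^ 4 * (1 - k t * f n t * k t)) ^ 2 := by
    nth_rw 1 [hk8 t ht]; ring
  rw [h1, hd]
  have hen := he n
  have hk4 : 0 ≤ k t ^ 4 := by positivity
  gcongr
  rw [← mul_div_assoc, div_le_iff₀ (hden n t)]
  nlinarith [sq_nonneg (e n ^ 2)]

end Factorization


/-- Given closed subspaces `X i j` of a C*-algebra `A` with `(X i j)* = X j i`,
`X i j * X j k ⊆ X i k` and `X 0 0 * X 1 1 = 0`:
(a) every `x ∈ X i j` factors as `x = a y b` with `a = |x*|^{1/4} = (x x*)^{1/8} ∈ X i i`,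
`b = |x|^{1/4} = (x* x)^{1/8} ∈ X j j` (and in particular `|x| ∈ X j j`, `|x*| ∈ X i i`);
(b) `X i j * X k l = 0` whenever `j ≠ k`; and
(c) `X i j ∩ X k l = 0` whenever `(i,j) ≠ (k,l)`. -/
theorem stmt3 {A : Type*} [NonUnitalCStarAlgebra A] [PartialOrder A] [StarOrderedRing A]
    (X : Fin 2 → Fin 2 → Submodule ℂ A)
    (hclosed : ∀ i j, IsClosed (X i j : Set A))
    (hstar : ∀ i j, ∀ a ∈ X i j, star a ∈ X j i)
    (hmul : ∀ i j k, ∀ a ∈ X i j, ∀ b ∈ X j k, a * b ∈ X i k)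
    (horth : ∀ a ∈ X 0 0, ∀ b ∈ X 1 1, a * b = 0) :
    (∀ i j, ∀ x ∈ X i j,
      CFC.sqrt (star x * x) ∈ X j j ∧ CFC.sqrt (x * star x) ∈ X i i ∧
      CFC.nnrpow (x * star x) (8⁻¹ : ℝ≥0) ∈ X i i ∧
      CFC.nnrpow (star x * x) (8⁻¹ : ℝ≥0) ∈ X j j ∧
      ∃ y : A, x = CFC.nnrpow (x * star x) (8⁻¹ : ℝ≥0) * y *
        CFC.nnrpow (star x * x) (8⁻¹ : ℝ≥0)) ∧
    (∀ i j k l : Fin 2, j ≠ k → ∀ a ∈ X i j, ∀ b ∈ X k l, a * b = 0) ∧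
    (∀ i j k l : Fin 2, (i, j) ≠ (k, l) → ∀ a, a ∈ X i j → a ∈ X k l → a = 0) := by

  have hcfc (i : Fin 2) (f : ℝ → ℝ) (a : A) (ha : a ∈ X i i) : cfcₙ f a ∈ X i i := by
    let S : NonUnitalStarSubalgebra ℂ A :=
      { X i i with
        mul_mem' := fun {a b} ha hb ↦ hmul i i i a ha b hb
        star_mem' := fun {a} ha ↦ hstar i i a ha }
    have : IsClosed (S : Set A) := hclosed i i
    exact cfcₙ_mem (s := S) f ha
  have hnnrpow (i : Fin 2) (p : ℝ≥0) (a : A) (h0 : 0 ≤ a) (ha : a ∈ X i i) :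
      CFC.nnrpow a p ∈ X i i := by
    have := CFC.nnrpow_eq_cfcₙ_real a p h0
    rw [← CFC.nnrpow_eq_pow] at this
    exact this ▸ hcfc i _ a ha
  have hsqrt (i : Fin 2) (a : A) (h0 : 0 ≤ a) (ha : a ∈ X i i) : CFC.sqrt a ∈ X i i :=
    CFC.sqrt_eq_real_sqrt a h0 ▸ hcfc i _ a ha
  have hfactor : ∀ i j, ∀ x ∈ X i j,
      CFC.sqrt (star x * x) ∈ X j j ∧ CFC.sqrt (x * star x) ∈ X i i ∧
      CFC.nnrpow (x * star x) (8⁻¹ : ℝ≥0) ∈ X i i ∧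
      CFC.nnrpow (star x * x) (8⁻¹ : ℝ≥0) ∈ X j j ∧
      ∃ y : A, x = CFC.nnrpow (x * star x) (8⁻¹ : ℝ≥0) * y *
        CFC.nnrpow (star x * x) (8⁻¹ : ℝ≥0) := by
    intro i j x hx
    have hl := hmul i j i x hx _ (hstar i j x hx)
    have hr := hmul j i j _ (hstar i j x hx) x hx
    exact ⟨hsqrt j _ (star_mul_self_nonneg x) hr, hsqrt i _ (mul_star_self_nonneg x) hl,
      hnnrpow i _ _ (mul_star_self_nonneg x) hl, hnnrpow j _ _ (star_mul_self_nonneg x) hr,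
      exists_eq_nnrpow_mul_mul_nnrpow x⟩
  have hdiag : ∀ j k : Fin 2, j ≠ k → ∀ a ∈ X j j, ∀ b ∈ X k k, a * b = 0 := by
    intro j k hjk a ha b hb
    fin_cases j <;> fin_cases k
    · exact absurd rfl hjk
    · exact horth a ha b hb
    · simpa using congr(star $(horth _ (hstar 0 0 b hb) _ (hstar 1 1 a ha)))
    · exact absurd rfl hjk
  have hzero : ∀ i j k l : Fin 2, j ≠ k → ∀ a ∈ X i j, ∀ b ∈ X k l, a * b = 0 := by
    intro i j k l hjk a ha b hb
    obtain ⟨-, -, -, har, y, hy⟩ := hfactor i j a ha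
    obtain ⟨-, -, hbl, -, z, hz⟩ := hfactor k l b hb
    rw [hy, hz, mul_assoc (CFC.nnrpow (b * star b) _), mul_assoc _ (CFC.nnrpow (star a * a) _),
      ← mul_assoc (CFC.nnrpow (star a * a) _), hdiag j k hjk _ har _ hbl, zero_mul, mul_zero]
  refine ⟨hfactor, hzero, fun i j k l hne a ha hb ↦ ?_⟩
  by_cases hik : i = k
  · have hjl : j ≠ l := fun h ↦ hne (by rw [hik, h])
    exact CStarRing.mul_star_self_eq_zero_iff a |>.1 (hzero i j l k hjl a ha _ (hstar k l a hb))
  · exact CStarRing.star_mul_self_eq_zero_iff a |>.1 (hzero j i k l hik _ (hstar i j a ha) a hb)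
end

section
/- Suppose I is a closed two-sided ideal in a C*-algebra A and h and k are positive elements of A. Then I ∩ closure({k a h : a ∈ A}) = closure({k a h : a ∈ I}), where closures are taken in the norm topology of A. -/
theorem IsSelfAdjoint.exists_norm_mul_le_one_and_norm_mul_mul_sub_le
    {A : Type*} [NonUnitalCStarAlgebra A] {k : A} (hk : IsSelfAdjoint k) {ε : ℝ} (hε : 0 < ε) :
    ∃ b : A, ‖k * b‖ ≤ 1 ∧ ‖k * b * k - k‖ ≤ ε := by
  have hpos (t : ℝ) : 0 < t ^ 2 + ε ^ 2 := by positivity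
  have hcont : Continuous fun t : ℝ ↦ t / (t ^ 2 + ε ^ 2) :=
    continuous_id.div (by fun_prop) fun t ↦ (hpos t).ne'
  have hmul : k * cfcₙ (fun t : ℝ ↦ t / (t ^ 2 + ε ^ 2)) k =
      cfcₙ (fun t : ℝ ↦ t * (t / (t ^ 2 + ε ^ 2))) k := by
    rw [cfcₙ_mul (fun t : ℝ ↦ t) _ k (by fun_prop) (by simp) hcont.continuousOn (by simp),
      cfcₙ_id' ℝ k]
  refine ⟨cfcₙ (fun t : ℝ ↦ t / (t ^ 2 + ε ^ 2)) k, ?_, ?_⟩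
  · rw [hmul]
    refine norm_cfcₙ_le fun t _ ↦ ?_
    rw [Real.norm_eq_abs, ← mul_div_assoc,
      abs_of_nonneg (div_nonneg (mul_self_nonneg t) (hpos t).le),
      div_le_one (hpos t)]
    nlinarith
  · have hsub : k * cfcₙ (fun t : ℝ ↦ t / (t ^ 2 + ε ^ 2)) k * k - k =
        cfcₙ (fun t : ℝ ↦ t * (t / (t ^ 2 + ε ^ 2)) * t - t) k := by
      rw [hmul, cfcₙ_sub _ (fun t : ℝ ↦ t) k (by fun_prop) (by simp) (by fun_prop) (by simp),
        cfcₙ_mul _ (fun t : ℝ ↦ t) k (by fun_prop) (by simp) (by fun_prop) (by simp),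
        cfcₙ_id' ℝ k]
    rw [hsub]
    refine norm_cfcₙ_le fun t _ ↦ ?_
    have heq : t * (t / (t ^ 2 + ε ^ 2)) * t - t = -(t * ε ^ 2) / (t ^ 2 + ε ^ 2) := by
      have := (hpos t).ne'
      field_simp
      ring
    rw [heq, Real.norm_eq_abs, abs_div, abs_neg, abs_mul, abs_of_pos (hpos t),
      abs_of_pos (pow_pos hε 2), div_le_iff₀ (hpos t)]
    nlinarith [sq_nonneg (|t| - ε), sq_abs t, abs_nonneg t, mul_nonneg hε.le (sq_nonneg (|t| - ε)),
      mul_nonneg (abs_nonneg t) (sq_nonneg ε)]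

theorem IsSelfAdjoint.exists_norm_mul_mul_sub_lt_of_mem_closure
    {A : Type*} [NonUnitalCStarAlgebra A] {k x : A} (hk : IsSelfAdjoint k)
    (hx : x ∈ closure (Set.range (k * ·))) {ε : ℝ} (hε : 0 < ε) :
    ∃ b : A, ‖k * b‖ ≤ 1 ∧ ‖k * b * x - x‖ < ε := by
  obtain ⟨_, ⟨a, rfl⟩, ha⟩ := Metric.mem_closure_iff.mp hx (ε / 3) (by positivity)
  rw [dist_eq_norm] at ha
  have hpos : 0 < ‖a‖ + 1 := by positivity
  obtain ⟨b, hb, hbk⟩ :=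
    hk.exists_norm_mul_le_one_and_norm_mul_mul_sub_le (ε := ε / 3 / (‖a‖ + 1)) (by positivity)
  refine ⟨b, hb, ?_⟩
  have h₁ : ‖k * b * (x - k * a)‖ ≤ ‖x - k * a‖ :=
    (norm_mul_le _ _).trans (mul_le_of_le_one_left (norm_nonneg _) hb)
  have h₂ : ‖(k * b * k - k) * a‖ ≤ ε / 3 := calc
    _ ≤ ε / 3 / (‖a‖ + 1) * (‖a‖ + 1) := (norm_mul_le _ _).trans (by gcongr; linarith)
    _ = ε / 3 := div_mul_cancel₀ _ hpos.ne'
  calc ‖k * b * x - x‖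
      = ‖k * b * (x - k * a) + (k * b * k - k) * a - (x - k * a)‖ := by
        congr 1; noncomm_ring
    _ ≤ ‖k * b * (x - k * a)‖ + ‖(k * b * k - k) * a‖ + ‖x - k * a‖ :=
        (norm_sub_le _ _).trans (by gcongr; exact norm_add_le _ _)
    _ < ε := by linarith

/-- If `I` is a closed two-sided ideal in a C*-algebra `A` and `h, k ∈ A` are
positive, then `I ∩ closure (k A h) = closure (k I h)`. -/
theorem stmt8 {A : Type*} [NonUnitalCStarAlgebra A] [PartialOrder A] [StarOrderedRing A]
    (I : TwoSidedIdeal A) (hI : IsClosed (I : Set A))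
    (h k : A) (hh : 0 ≤ h) (hk : 0 ≤ k) :
    (I : Set A) ∩ closure {y : A | ∃ a : A, y = k * a * h} =
      closure {y : A | ∃ a ∈ I, y = k * a * h} := by
  refine subset_antisymm ?_ (Set.subset_inter ?_ ?_)
  · rintro x ⟨hxI, hx⟩
    have hxk : x ∈ closure (Set.range (k * ·)) := by
      refine closure_mono ?_ hx
      rintro _ ⟨a, rfl⟩
      exact ⟨a * h, (mul_assoc k a h).symm⟩
    have hxh : star x ∈ closure (Set.range (h * ·)) := by
      refine map_mem_closure continuous_star hx ?_
      rintro _ ⟨a, rfl⟩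
      exact ⟨star a * k, by
        simp [hh.isSelfAdjoint.star_eq, hk.isSelfAdjoint.star_eq, mul_assoc]⟩
    refine Metric.mem_closure_iff.mpr fun ε hε ↦ ?_
    obtain ⟨b, -, hbx⟩ :=
      hk.isSelfAdjoint.exists_norm_mul_mul_sub_lt_of_mem_closure hxk (half_pos hε)
    obtain ⟨c, hc, hcx⟩ :=
      hh.isSelfAdjoint.exists_norm_mul_mul_sub_lt_of_mem_closure hxh (half_pos hε)
    rw [← norm_star] at hc hcx
    simp only [star_sub, star_mul, star_star, hh.isSelfAdjoint.star_eq] at hc hcx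
    refine ⟨k * (b * x * star c) * h,
      ⟨_, I.mul_mem_right _ _ (I.mul_mem_left _ _ hxI), rfl⟩, ?_⟩
    rw [dist_comm, dist_eq_norm]
    calc ‖k * (b * x * star c) * h - x‖
        = ‖(k * b * x - x) * (star c * h) + (x * (star c * h) - x)‖ := by
          congr 1; noncomm_ring
      _ ≤ ‖k * b * x - x‖ + ‖x * (star c * h) - x‖ :=
          (norm_add_le _ _).trans (by
            gcongr
            exact (norm_mul_le _ _).trans (mul_le_of_le_one_right (norm_nonneg _) hc))
      _ < ε := by linarith
  · refine closure_minimal ?_ hI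
    rintro _ ⟨a, ha, rfl⟩
    exact I.mul_mem_right _ _ (I.mul_mem_left _ _ ha)
  · refine closure_mono ?_
    rintro _ ⟨a, -, rfl⟩
    exact ⟨a, rfl⟩
end

section
/- Let π : A → B be a surjective *-homomorphism of C*-algebras, and suppose h, x, k ∈ B satisfy hk = 0 and 0 ≤ T(h,x,k) ≤ 1 in M₂(B̃). Then there exist h', x', k' ∈ A with π(h') = h, π(x') = x, π(k') = k, such that h'k' = 0 and 0 ≤ T(h',x',k') ≤ 1 in M₂(Ã). (This expresses that the universal C*-algebra 𝒫 on generators h, x, k with relations hk = 0 and 0 ≤ T(h,x,k) ≤ 1 is projective.) -/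
/-- The matrix `T(h,x,k) = [[1 - h, x*], [x, k]]` over the unitization of `A`. -/
noncomputable def Tmat {A : Type*} [NonUnitalCStarAlgebra A] (h x k : A) :
    Matrix (Fin 2) (Fin 2) (Unitization ℂ A) :=
  !![1 - (h : Unitization ℂ A), star (x : Unitization ℂ A);
     (x : Unitization ℂ A), (k : Unitization ℂ A)]

/-- `0 ≤ T ≤ 1` for a matrix over the unitization: `T` is a positive element of the C*-algebra
`M₂(Ã)` with spectrum contained in `[0,1]`, i.e. `T` is self-adjoint with spectrum in `[0,1]`. -/
def IsPosUnitInterval {A : Type*} [NonUnitalCStarAlgebra A]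
    (T : Matrix (Fin 2) (Fin 2) (Unitization ℂ A)) : Prop :=
  IsSelfAdjoint T ∧ spectrum ℂ T ⊆ Complex.ofReal '' Set.Icc (0 : ℝ) 1

open Polynomial in
/-- If `T v = l v` for a self-adjoint `T`, then `f(T) v = f(l) v`. -/
theorem cfc_mul_of_mul_eq_smul {C : Type*} [CStarAlgebra C] {T v : C} (hT : IsSelfAdjoint T)
    {l : ℝ} (hv : T * v = l • v) {f : ℝ → ℝ} (hf : Continuous f) :
    cfc f T * v = f l • v := by
  have hpoly : ∀ p : ℝ[X], aeval T p * v = p.eval l • v := by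
    intro p
    induction p using Polynomial.induction_on' with
    | add p q hp hq => simp [add_mul, add_smul, hp, hq]
    | monomial n a =>
      have hpow : ∀ n : ℕ, T ^ n * v = l ^ n • v := by
        intro n
        induction n with
        | zero => simp
        | succ n ih => rw [pow_succ, mul_assoc, hv, mul_smul_comm, ih, smul_smul, pow_succ']
      simp [aeval_monomial, eval_monomial, hpow, ← Algebra.smul_def, smul_smul]
  obtain ⟨R, hR⟩ := (spectrum.isCompact (𝕜 := ℝ) T).isBounded.subset_closedBall 0
  set r := max R |l|
  have hspec : ∀ t ∈ spectrum ℝ T, t ∈ Set.Icc (-r) r := by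
    intro t ht
    have h1 := hR ht
    rw [mem_closedBall_zero_iff, Real.norm_eq_abs] at h1
    exact abs_le.mp (h1.trans (le_max_left _ _))
  have hl : l ∈ Set.Icc (-r) r := abs_le.mp (le_max_right _ _)
  rw [← sub_eq_zero, ← norm_le_zero_iff]
  refine le_of_forall_pos_le_add fun ε hε ↦ ?_
  set δ := ε / (2 * (‖v‖ + 1))
  have hδ : 0 < δ := by positivity
  obtain ⟨p, hp⟩ := exists_polynomial_near_of_continuousOn (-r) r f hf.continuousOn δ hδ
  have h1 : ‖cfc f T - aeval T p‖ ≤ δ := by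
    rw [← cfc_polynomial p T, ← cfc_sub f _ T]
    refine norm_cfc_le hδ.le fun t ht ↦ ?_
    rw [norm_sub_rev]
    exact (hp t (hspec t ht)).le
  have h2 : ‖(p.eval l - f l) • v‖ ≤ δ * ‖v‖ := by
    rw [norm_smul]
    exact mul_le_mul_of_nonneg_right (hp l hl).le (norm_nonneg _)
  have h3 : cfc f T * v - f l • v
      = (cfc f T - aeval T p) * v + (p.eval l - f l) • v := by
    rw [sub_mul, hpoly, sub_smul]; abel
  rw [h3]
  calc _ ≤ ‖(cfc f T - aeval T p) * v‖ + ‖(p.eval l - f l) • v‖ := norm_add_le _ _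
    _ ≤ δ * ‖v‖ + δ * ‖v‖ := by
      gcongr
      exact (norm_mul_le _ _).trans (by gcongr)
    _ ≤ 0 + ε := by
      have : δ * (2 * (‖v‖ + 1)) = ε := by simp only [δ]; field_simp
      nlinarith

theorem exists_nonneg_pow_four {C : Type*} [NonUnitalCStarAlgebra C] [PartialOrder C]
    [StarOrderedRing C] {k : C} (hk : 0 ≤ k) : ∃ r : C, 0 ≤ r ∧ r * r * (r * r) = k :=
  ⟨CFC.sqrt (CFC.sqrt k), CFC.sqrt_nonneg _, by
    rw [CFC.sqrt_mul_sqrt_self _ (CFC.sqrt_nonneg _), CFC.sqrt_mul_sqrt_self _ hk]⟩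

theorem mul_eq_zero_of_mul_self_mul_eq_zero {C : Type*} [NonUnitalCStarAlgebra C] {r a : C}
    (hr : IsSelfAdjoint r) (h : r * r * a = 0) : r * a = 0 := by
  rw [← CStarRing.star_mul_self_eq_zero_iff, star_mul, hr.star_eq, mul_assoc, ← mul_assoc r, h,
    mul_zero]

theorem mul_eq_zero_of_pow_four_mul_eq_zero {C : Type*} [NonUnitalCStarAlgebra C] {r a : C}
    (hr : IsSelfAdjoint r) (h : r * r * (r * r) * a = 0) : r * a = 0 :=
  mul_eq_zero_of_mul_self_mul_eq_zero hr <| mul_eq_zero_of_mul_self_mul_eq_zero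
    (by simpa [hr.star_eq] using IsSelfAdjoint.star_mul_self r) h

theorem norm_mul_le_of_star_mul_self_le {C : Type*} [NonUnitalCStarAlgebra C] [PartialOrder C]
    [StarOrderedRing C] {c b : C} (h : star c * c ≤ star b * b) (z : C) : ‖c * z‖ ≤ ‖b * z‖ := by
  have h1 : star (c * z) * (c * z) ≤ star (b * z) * (b * z) := by
    have := star_left_conjugate_le_conjugate h z
    simpa only [star_mul, mul_assoc] using this
  have h2 := CStarAlgebra.norm_le_norm_of_nonneg_of_le (star_mul_self_nonneg _) h1
  rw [CStarRing.norm_star_mul_self, CStarRing.norm_star_mul_self] at h2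
  exact (mul_self_le_mul_self_iff (norm_nonneg _) (norm_nonneg _)).mpr h2

theorem norm_mul_sub_self_le_of_star_mul_self_le {C : Type*} [NonUnitalCStarAlgebra C]
    [PartialOrder C] [StarOrderedRing C] {c b : C} (h : star c * c ≤ star b * b) (w : C) :
    ‖c * w - c‖ ≤ ‖b * w - b‖ := by
  have h1 : star (c : Unitization ℂ C) * c ≤ star (b : Unitization ℂ C) * b := by
    simpa using (Unitization.inr_le_iff _ _ (.star_mul_self c) (.star_mul_self b)).mpr h
  have h2 := norm_mul_le_of_star_mul_self_le h1 ((w : Unitization ℂ C) - 1)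
  rw [mul_sub, mul_sub, mul_one, mul_one] at h2
  simpa only [← Unitization.inr_mul, ← Unitization.inr_sub, Unitization.norm_inr] using h2

open Filter Topology in
/-- If `c* c ≤ r⁴` then `c` factors through `r`, and the factor is killed on the left by
everything that kills `c`. -/
theorem exists_eq_mul_of_star_mul_self_le {C : Type*} [NonUnitalCStarAlgebra C] [PartialOrder C]
    [StarOrderedRing C] {c r : C} (hr : IsSelfAdjoint r)
    (h : star c * c ≤ r * r * (r * r)) :
    ∃ u, c = u * r ∧ ∀ z, z * c = 0 → z * u = 0 := by
  have hrr : star (r * r) * (r * r) = r * r * (r * r) := by simp [hr.star_eq]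
  have hle := norm_mul_le_of_star_mul_self_le (hrr ▸ h)
  let g : ℕ → ℝ → ℝ := fun n t ↦ t / (t ^ 2 + (1 / (n + 1 : ℝ)) ^ 2)
  have hden : ∀ n t, (0 : ℝ) < t ^ 2 + (1 / ((n : ℕ) + 1 : ℝ)) ^ 2 := fun n t ↦ by positivity
  have hg : ∀ n, Continuous (g n) := fun n ↦
    continuous_id.div (by fun_prop) fun t ↦ (hden n t).ne'
  have hg0 : ∀ n, g n 0 = 0 := fun n ↦ by simp [g]
  have hrid : cfcₙ (fun t : ℝ ↦ t) r = r := cfcₙ_id' ℝ r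
  have hrr' : r * r = cfcₙ (fun t : ℝ ↦ t * t) r := by
    rw [cfcₙ_mul (fun t : ℝ ↦ t) (fun t ↦ t) r, hrid]
  have hdiff : ∀ n m t, n ≤ m → |t * t * (g n t - g m t)| ≤ 1 / (n + 1 : ℝ) := by
    intro n m t hnm
    have hδε : 1 / (m + 1 : ℝ) ≤ 1 / (n + 1 : ℝ) := by gcongr
    have hδ : 0 < 1 / (m + 1 : ℝ) := by positivity
    have hn := hden n t
    have hm := hden m t
    simp only [g]
    set δ := 1 / (m + 1 : ℝ)
    set ε := 1 / (n + 1 : ℝ)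
    have hε : 0 < ε := hδ.trans_le hδε
    have heq : t * t * (t / (t ^ 2 + ε ^ 2) - t / (t ^ 2 + δ ^ 2))
        = -(t ^ 2 / (t ^ 2 + δ ^ 2) * (t * (ε ^ 2 - δ ^ 2) / (t ^ 2 + ε ^ 2))) := by
      field_simp
      ring
    have h1 : |t ^ 2 / (t ^ 2 + δ ^ 2)| ≤ 1 := by
      rw [abs_of_nonneg (by positivity), div_le_one hm]
      nlinarith
    have h2 : |t * (ε ^ 2 - δ ^ 2) / (t ^ 2 + ε ^ 2)| ≤ ε := by
      have h3 : 0 ≤ ε ^ 2 - δ ^ 2 := by nlinarith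
      rw [abs_div, abs_of_pos hn, div_le_iff₀ hn, abs_mul, abs_of_nonneg h3, ← sq_abs t]
      have h4 : 0 ≤ ε * (|t| - ε) ^ 2 := by positivity
      have h5 : 0 ≤ ε * (|t| * ε) := by positivity
      have h6 : |t| * (ε ^ 2 - δ ^ 2) ≤ |t| * ε ^ 2 := by
        gcongr
        nlinarith
      nlinarith
    rw [heq, abs_neg, abs_mul]
    calc _ ≤ 1 * ε := by gcongr
      _ = ε := one_mul _
  have hcauchy : CauchySeq fun n ↦ c * cfcₙ (g n) r := by
    refine cauchySeq_of_le_tendsto_0' (fun n : ℕ ↦ 1 / (n + 1 : ℝ)) (fun n m hnm ↦ ?_)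
      tendsto_one_div_add_atTop_nhds_zero_nat
    rw [dist_eq_norm, ← mul_sub]
    refine (hle _).trans ?_
    rw [← cfcₙ_sub (g n) (g m) r (hg n).continuousOn (hg0 n) (hg m).continuousOn (hg0 m),
      hrr', ← cfcₙ_mul (fun t ↦ t * t) (fun t ↦ g n t - g m t) r (by fun_prop) (by simp)
        ((hg n).sub (hg m)).continuousOn (by simp [hg0])]
    exact norm_cfcₙ_le fun t _ ↦ hdiff n m t hnm
  obtain ⟨u, hu⟩ := cauchySeq_tendsto_of_complete hcauchy
  refine ⟨u, ?_, fun z hz ↦ ?_⟩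
  · refine tendsto_nhds_unique ?_ (hu.mul_const r)
    rw [tendsto_iff_norm_sub_tendsto_zero]
    refine squeeze_zero (fun _ ↦ norm_nonneg _) (fun n ↦ ?_)
      tendsto_one_div_add_atTop_nhds_zero_nat
    have hgr : cfcₙ (g n) r * r = cfcₙ (fun t ↦ g n t * t) r := by
      rw [cfcₙ_mul (g n) (fun t ↦ t) r (hg n).continuousOn (hg0 n), hrid]
    have hgc : ContinuousOn (fun t ↦ g n t * t) (quasispectrum ℝ r) :=
      ((hg n).mul continuous_id).continuousOn
    rw [mul_assoc]
    refine (norm_mul_sub_self_le_of_star_mul_self_le (hrr ▸ h) _).trans ?_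
    rw [hgr, hrr', ← cfcₙ_mul (fun t ↦ t * t) (fun t ↦ g n t * t) r (by fun_prop) (by simp) hgc
        (by simp), ← cfcₙ_sub (fun t ↦ t * t * (g n t * t)) (fun t ↦ t * t) r
        (ContinuousOn.mul (by fun_prop) hgc) (by simp)]
    refine norm_cfcₙ_le fun t _ ↦ ?_
    have hn := hden n t
    have hε : 0 < 1 / (n + 1 : ℝ) := by positivity
    have hε1 : 1 / (n + 1 : ℝ) ≤ 1 := by
      rw [div_le_one (by positivity)]; linarith [Nat.cast_nonneg (α := ℝ) n]
    simp only [g]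
    set ε := 1 / (n + 1 : ℝ)
    have heq : t * t * (t / (t ^ 2 + ε ^ 2) * t) - t * t
        = -(t ^ 2 * ε ^ 2 / (t ^ 2 + ε ^ 2)) := by
      field_simp
      ring
    rw [heq, norm_neg, Real.norm_of_nonneg (by positivity), div_le_iff₀ hn]
    calc t ^ 2 * ε ^ 2 ≤ t ^ 2 * ε := by gcongr; nlinarith
      _ ≤ ε * (t ^ 2 + ε ^ 2) := by nlinarith [pow_pos hε 3]
  · refine tendsto_nhds_unique (hu.const_mul z) ?_
    simp [← mul_assoc, hz]

theorem spectrum_real_subset_Icc {C : Type*} [CStarAlgebra C] {T : C}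
    (hspec : spectrum ℂ T ⊆ Complex.ofReal '' Set.Icc (0 : ℝ) 1) :
    spectrum ℝ T ⊆ Set.Icc 0 1 := by
  intro t ht
  obtain ⟨s, hs, hst⟩ := hspec (spectrum.algebraMap_mem ℂ ht)
  rwa [show t = s from (Complex.ofReal_injective hst).symm]

theorem exists_sub_mul_self_eq_star_mul_self {C : Type*} [CStarAlgebra C] {T : C}
    (hT : IsSelfAdjoint T) (hspec : spectrum ℂ T ⊆ Complex.ofReal '' Set.Icc (0 : ℝ) 1) :
    ∃ D : C, T - T * T = star D * D := by
  let _ := CStarAlgebra.spectralOrder C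
  have _ := CStarAlgebra.spectralOrderedRing C
  rw [← CStarAlgebra.nonneg_iff_eq_star_mul_self]
  have : T - T * T = cfc (fun t : ℝ ↦ t - t * t) T := by
    rw [cfc_sub (fun t : ℝ ↦ t) (fun t ↦ t * t) T, cfc_mul (fun t : ℝ ↦ t) (fun t ↦ t) T,
      cfc_id' ℝ T]
  rw [this]
  refine cfc_nonneg fun t ht ↦ ?_
  obtain ⟨h0, h1⟩ := spectrum_real_subset_Icc hspec ht
  nlinarith

open CStarAlgebra in
/-- A self-adjoint lift of an element with spectrum in `[0,1]` can be corrected to one with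
spectrum in `[0,1]` that still fixes or kills whatever the original lift fixed or killed. -/
theorem exists_lift_spectrum_subset_Icc {C D : Type*} [CStarAlgebra C] [CStarAlgebra D]
    (φ : C →⋆ₐ[ℂ] D) {M : C} (hM : IsSelfAdjoint M)
    (hspec : spectrum ℂ (φ M) ⊆ Complex.ofReal '' Set.Icc (0 : ℝ) 1) :
    ∃ N : C, IsSelfAdjoint N ∧ spectrum ℂ N ⊆ Complex.ofReal '' Set.Icc (0 : ℝ) 1 ∧
      φ N = φ M ∧ (∀ v, M * v = v → N * v = v) ∧ ∀ v, M * v = 0 → N * v = 0 := by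
  let f : ℝ → ℝ := fun t ↦ max 0 (min t 1)
  have hf : Continuous f := by fun_prop
  have hN : IsSelfAdjoint (cfc f M) := cfc_predicate f M
  refine ⟨cfc f M, hN, ?_, ?_, fun v hv ↦ ?_, fun v hv ↦ ?_⟩
  · rw [← hN.spectrumRestricts.algebraMap_image]
    refine Set.image_mono ?_
    rw [cfc_map_spectrum f M]
    rintro _ ⟨t, -, rfl⟩
    exact ⟨le_max_left _ _, max_le zero_le_one (min_le_right _ _)⟩
  · rw [StarAlgHom.map_cfc φ f M hf.continuousOn (map_continuous φ)]
    conv_rhs => rw [← cfc_id ℝ (φ M) (hM.map φ)]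
    refine cfc_congr fun t ht ↦ ?_
    obtain ⟨h0, h1⟩ := spectrum_real_subset_Icc hspec ht
    simp [f, h0, h1]
  · simpa [f] using cfc_mul_of_mul_eq_smul (l := 1) hM (by simpa using hv) hf
  · simpa [f] using cfc_mul_of_mul_eq_smul (l := 0) hM (by simpa using hv) hf

theorem spectrum_ofMatrix {A : Type*} [CStarAlgebra A] (T : Matrix (Fin 2) (Fin 2) A) :
    spectrum ℂ (CStarMatrix.ofMatrix T) = spectrum ℂ T :=
  AlgEquiv.spectrum_eq (CStarMatrix.ofMatrixStarAlgEquiv (n := Fin 2) (A := A)) T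

theorem isSelfAdjoint_Tmat_iff {A : Type*} [NonUnitalCStarAlgebra A] {h x k : A} :
    IsSelfAdjoint (Tmat h x k) ↔ IsSelfAdjoint h ∧ IsSelfAdjoint k := by
  refine ⟨fun hT ↦ ⟨?_, ?_⟩, fun ⟨hh, hk⟩ ↦ ?_⟩
  · have : star (1 - (h : Unitization ℂ A)) = 1 - (h : Unitization ℂ A) :=
      congrFun (congrFun hT 0) 0
    rw [star_sub, star_one, sub_right_inj, ← Unitization.inr_star] at this
    exact Unitization.inr_injective this
  · have : star (k : Unitization ℂ A) = (k : Unitization ℂ A) := congrFun (congrFun hT 1) 1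
    rw [← Unitization.inr_star] at this
    exact Unitization.inr_injective this
  · refine Matrix.ext fun i j ↦ ?_
    fin_cases i <;> fin_cases j <;>
      simp [Tmat, Matrix.star_apply, ← Unitization.inr_star, hh.star_eq, hk.star_eq]

theorem IsPosUnitInterval.star_mul_self_le {A : Type*} [NonUnitalCStarAlgebra A] [PartialOrder A]
    [StarOrderedRing A] {h x k : A} (hT : IsPosUnitInterval (Tmat h x k)) :
    star x * x ≤ h ∧ x * star x ≤ k := by
  obtain ⟨hh, hk⟩ := isSelfAdjoint_Tmat_iff.mp hT.1
  obtain ⟨D, hD⟩ := exists_sub_mul_self_eq_star_mul_self (T := CStarMatrix.ofMatrix (Tmat h x k))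
    hT.1 ((spectrum_ofMatrix (Tmat h x k)).trans_subset hT.2)
  have hpos : ∀ i, 0 ≤ (star D * D) i i := fun i ↦ by
    rw [CStarMatrix.mul_apply]
    exact Finset.sum_nonneg fun j _ ↦ star_mul_self_nonneg (D j i)
  have h00 : (CStarMatrix.ofMatrix (Tmat h x k)) 0 0 = 1 - (h : Unitization ℂ A) := rfl
  have h01 : (CStarMatrix.ofMatrix (Tmat h x k)) 0 1 = star (x : Unitization ℂ A) := rfl
  have h10 : (CStarMatrix.ofMatrix (Tmat h x k)) 1 0 = (x : Unitization ℂ A) := rfl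
  have h11 : (CStarMatrix.ofMatrix (Tmat h x k)) 1 1 = (k : Unitization ℂ A) := rfl
  constructor
  · rw [← Unitization.inr_le_iff _ _ (.star_mul_self x) hh, ← sub_nonneg]
    have h1 := hpos 0
    rw [← hD, CStarMatrix.sub_apply, CStarMatrix.mul_apply, Fin.sum_univ_two, h00, h01, h10] at h1
    have h2 := star_mul_self_nonneg (h : Unitization ℂ A)
    rw [← Unitization.inr_star, hh.star_eq] at h2
    convert add_nonneg h1 h2 using 1
    rw [Unitization.inr_mul, Unitization.inr_star]
    noncomm_ring
  · rw [← Unitization.inr_le_iff _ _ (.mul_star_self x) hk, ← sub_nonneg]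
    have h1 := hpos 1
    rw [← hD, CStarMatrix.sub_apply, CStarMatrix.mul_apply, Fin.sum_univ_two, h11, h01, h10] at h1
    have h2 := star_mul_self_nonneg (k : Unitization ℂ A)
    rw [← Unitization.inr_star, hk.star_eq] at h2
    convert add_nonneg h1 h2 using 1
    rw [Unitization.inr_mul, Unitization.inr_star]
    noncomm_ring

/-- Entrywise application of a unital star homomorphism to a matrix. -/
noncomputable def CStarMatrix.mapStarAlgHom {A B : Type*} [CStarAlgebra A] [CStarAlgebra B]
    (φ : A →⋆ₐ[ℂ] B) :
    CStarMatrix (Fin 2) (Fin 2) A →⋆ₐ[ℂ] CStarMatrix (Fin 2) (Fin 2) B where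
  toFun M := M.map φ
  map_one' := Matrix.map_one φ (map_zero φ) (map_one φ)
  map_mul' _ _ := Matrix.map_mul (f := (φ : A →+* B))
  map_zero' := Matrix.map_zero φ (map_zero φ)
  map_add' M N := Matrix.map_add φ (map_add φ) M N
  commutes' r := Matrix.map_algebraMap r φ (map_zero φ) (AlgHomClass.commutes φ r)
  map_star' M := CStarMatrix.ext fun i j ↦ map_star φ (M j i)

/-- Orthogonal positive elements lift along surjections to orthogonal positive elements. -/
theorem exists_orthogonal_lift {A B : Type*} [NonUnitalCStarAlgebra A] [NonUnitalCStarAlgebra B]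
    [PartialOrder A] [StarOrderedRing A] [PartialOrder B] [StarOrderedRing B]
    (π : A →⋆ₙₐ[ℂ] B) (hπ : Function.Surjective π) {r s : B} (hr : 0 ≤ r) (hs : 0 ≤ s)
    (hrs : r * s = 0) :
    ∃ r' s' : A, π r' = r ∧ π s' = s ∧ 0 ≤ r' ∧ 0 ≤ s' ∧ r' * s' = 0 := by
  obtain ⟨b, hb⟩ := hπ (r - s)
  set a : A := (realPart b : A) with ha
  have hasa : IsSelfAdjoint a := (realPart b).2
  have hπa : π a = r - s := by
    rw [ha, realPart_apply_coe, ← Complex.coe_smul, map_smul, Complex.coe_smul, map_add, map_star, hb,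
      (hr.isSelfAdjoint.sub hs.isSelfAdjoint).star_eq, ← two_smul ℝ (r - s), smul_smul]
    norm_num
  obtain ⟨h1, h2⟩ := CFC.posPart_negPart_unique hπa hrs hr hs
  have h3 : π a = π a⁺ - π a⁻ := by rw [← map_sub, CFC.posPart_sub_negPart a hasa]
  obtain ⟨h4, h5⟩ := CFC.posPart_negPart_unique h3
    (by rw [← map_mul, CFC.posPart_mul_negPart, map_zero])
    (map_nonneg π (CFC.posPart_nonneg a)) (map_nonneg π (CFC.negPart_nonneg a))
  exact ⟨a⁺, a⁻, h4.symm.trans h1, h5.symm.trans h2, CFC.posPart_nonneg a, CFC.negPart_nonneg a,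
    CFC.posPart_mul_negPart a⟩

/-- Any lift of `(h, x, k)` whose matrix fixes `diag(r, 0)` and kills `diag(0, a)` for every `a`
annihilated by `r` can be corrected to a lift satisfying the relations. -/
theorem exists_lift_of_annihilator {A B : Type*} [NonUnitalCStarAlgebra A]
    [NonUnitalCStarAlgebra B] (π : A →⋆ₙₐ[ℂ] B) {h x k r : A}
    (hT : IsPosUnitInterval (Tmat (π h) (π x) (π k)))
    (hh : IsSelfAdjoint h) (hk : IsSelfAdjoint k) (hr : IsSelfAdjoint r)
    (hhr : h * r = 0) (hxr : x * r = 0)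
    (hxa : ∀ a, r * a = 0 → star x * a = 0) (hka : ∀ a, r * a = 0 → k * a = 0) :
    ∃ h' x' k' : A, π h' = π h ∧ π x' = π x ∧ π k' = π k ∧ h' * k' = 0 ∧
      IsPosUnitInterval (Tmat h' x' k') := by
  let _ := CStarAlgebra.spectralOrder A
  have _ := CStarAlgebra.spectralOrderedRing A
  let _ := CStarAlgebra.spectralOrder B
  have _ := CStarAlgebra.spectralOrderedRing B
  let Φ := CStarMatrix.mapStarAlgHom (Unitization.starMap π)
  have hΦ : Φ (CStarMatrix.ofMatrix (Tmat h x k))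
      = CStarMatrix.ofMatrix (Tmat (π h) (π x) (π k)) := by
    refine CStarMatrix.ext fun i j ↦ ?_
    change Unitization.starMap π (Tmat h x k i j) = Tmat (π h) (π x) (π k) i j
    fin_cases i <;> fin_cases j
    · change Unitization.starMap π (1 - (h : Unitization ℂ A)) = 1 - (π h : Unitization ℂ B)
      rw [map_sub, map_one, Unitization.starMap_inr]
    all_goals simp [Tmat, ← Unitization.inr_star, map_star]
  obtain ⟨N, hNsa, hNspec, hΦN, hfix, hker⟩ := exists_lift_spectrum_subset_Icc Φ
    (M := CStarMatrix.ofMatrix (Tmat h x k)) (isSelfAdjoint_Tmat_iff.mpr ⟨hh, hk⟩)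
    (by rw [hΦ]; exact (spectrum_ofMatrix _).trans_subset hT.2)
  have hentry : ∀ i j, Unitization.starMap π (N i j) = Tmat (π h) (π x) (π k) i j := fun i j ↦
    congrFun (congrFun (hΦN.trans hΦ) i) j
  have hfst : ∀ z : Unitization ℂ A, (Unitization.starMap π z).fst = z.fst := fun z ↦ by
    simp [Unitization.algebraMap_eq_inl]
  have hsnd : ∀ z : Unitization ℂ A, (Unitization.starMap π z).snd = π z.snd := fun z ↦ by
    simp [Unitization.algebraMap_eq_inl]
  obtain ⟨h', x', k', hN⟩ : ∃ h' x' k' : A, N = CStarMatrix.ofMatrix (Tmat h' x' k') := by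
    have h00 : N 0 0 = 1 - ((-(N 0 0).snd : A) : Unitization ℂ A) :=
      Unitization.ext (by rw [← hfst, hentry]; simp [Tmat, sub_eq_add_neg])
        (by simp [sub_eq_add_neg])
    have h10 : N 1 0 = ((N 1 0).snd : Unitization ℂ A) :=
      Unitization.ext (by rw [← hfst, hentry]; simp [Tmat]) (by simp)
    have h11 : N 1 1 = ((N 1 1).snd : Unitization ℂ A) :=
      Unitization.ext (by rw [← hfst, hentry]; simp [Tmat]) (by simp)
    have h01 : N 0 1 = star (N 1 0) := (congrFun (congrFun hNsa 0) 1).symm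
    refine ⟨-(N 0 0).snd, (N 1 0).snd, (N 1 1).snd, CStarMatrix.ext fun i j ↦ ?_⟩
    fin_cases i <;> fin_cases j
    · exact h00
    · exact h01.trans (congrArg star h10)
    · exact h10
    · exact h11
  subst hN
  have hsa' := isSelfAdjoint_Tmat_iff.mp hNsa
  have hV := hfix (CStarMatrix.ofMatrix !![(r : Unitization ℂ A), 0; 0, 0]) (by
    refine CStarMatrix.ext fun i j ↦ ?_
    rw [CStarMatrix.mul_apply, Fin.sum_univ_two]
    fin_cases i <;> fin_cases j <;>
      simp [Tmat, sub_mul, ← Unitization.inr_mul, hhr, hxr])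
  have hW := fun a (ha : r * a = 0) ↦
    hker (CStarMatrix.ofMatrix !![0, 0; 0, (a : Unitization ℂ A)]) (by
    refine CStarMatrix.ext fun i j ↦ ?_
    rw [CStarMatrix.mul_apply, Fin.sum_univ_two]
    fin_cases i <;> fin_cases j <;>
      simp [Tmat, ← Unitization.inr_star, ← Unitization.inr_mul, hxa a ha, hka a ha])
  have hhr' : h' * r = 0 := by
    have := congrFun (congrFun hV 0) 0
    rw [CStarMatrix.mul_apply, Fin.sum_univ_two] at this
    refine Unitization.inr_injective (R := ℂ) ?_
    simpa [Tmat, sub_mul, ← Unitization.inr_mul] using this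
  have hka' : ∀ a, r * a = 0 → k' * a = 0 := fun a ha ↦ by
    have := congrFun (congrFun (hW a ha) 1) 1
    rw [CStarMatrix.mul_apply, Fin.sum_univ_two] at this
    refine Unitization.inr_injective (R := ℂ) ?_
    simpa [Tmat, ← Unitization.inr_mul] using this
  refine ⟨h', x', k', ?_, ?_, ?_, ?_, hNsa, (spectrum_ofMatrix _).symm.trans_subset hNspec⟩
  · have := congrArg (fun z ↦ z.snd) (hentry 0 0)
    simp only [hsnd] at this
    simpa [Tmat, sub_eq_add_neg] using this
  · have := congrArg (fun z ↦ z.snd) (hentry 1 0)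
    simp only [hsnd] at this
    simpa [Tmat, sub_eq_add_neg] using this
  · have := congrArg (fun z ↦ z.snd) (hentry 1 1)
    simp only [hsnd] at this
    simpa [Tmat, sub_eq_add_neg] using this
  · have h1 : r * h' = 0 := by
      have := congrArg star hhr'
      rwa [star_mul, hr.star_eq, hsa'.1.star_eq, star_zero] at this
    have := congrArg star (hka' h' h1)
    rwa [star_mul, hsa'.1.star_eq, hsa'.2.star_eq, star_zero] at this

/-- Given a surjective *-homomorphism `π : A → B` and `h, x, k ∈ B` with
`hk = 0` and `0 ≤ T(h,x,k) ≤ 1`, there are lifts `h', x', k' ∈ A` satisfying the same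
relations: the universal C*-algebra `𝒫` is projective. -/
theorem stmt10 {A B : Type*} [NonUnitalCStarAlgebra A] [NonUnitalCStarAlgebra B]
    (π : A →⋆ₙₐ[ℂ] B) (hπ : Function.Surjective π) (h x k : B)
    (horth : h * k = 0) (hT : IsPosUnitInterval (Tmat h x k)) :
    ∃ h' x' k' : A, π h' = h ∧ π x' = x ∧ π k' = k ∧ h' * k' = 0 ∧
      IsPosUnitInterval (Tmat h' x' k') := by
  let _ := CStarAlgebra.spectralOrder A
  have _ := CStarAlgebra.spectralOrderedRing A
  let _ := CStarAlgebra.spectralOrder B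
  have _ := CStarAlgebra.spectralOrderedRing B
  obtain ⟨hxh, hxk⟩ := hT.star_mul_self_le
  have hh0 : 0 ≤ h := (star_mul_self_nonneg x).trans hxh
  have hk0 : 0 ≤ k := (mul_star_self_nonneg x).trans hxk
  obtain ⟨r, hr0, hrk⟩ := exists_nonneg_pow_four hk0
  have hr := hr0.isSelfAdjoint
  have hkh : k * h = 0 := by
    have := congrArg star horth
    rwa [star_mul, hh0.isSelfAdjoint.star_eq, hk0.isSelfAdjoint.star_eq, star_zero] at this
  have hrh : r * h = 0 := mul_eq_zero_of_pow_four_mul_eq_zero hr (hrk ▸ hkh)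
  obtain ⟨w, hw, hw0⟩ := exists_eq_mul_of_star_mul_self_le (c := star x) hr
    (by rwa [star_star, hrk])
  have hxw : x = r * star w := by
    rw [← star_star x, hw, star_mul, hr.star_eq]
  have hxk0 : x * k = 0 := by
    obtain ⟨s, hs0, hsh⟩ := exists_nonneg_pow_four hh0
    have hs := hs0.isSelfAdjoint
    have hsk : s * k = 0 := mul_eq_zero_of_pow_four_mul_eq_zero hs (hsh ▸ horth)
    have h1 := norm_mul_le_of_star_mul_self_le (c := x) (b := s * s)
      (by simpa [hs.star_eq, hsh] using hxh) k
    rw [mul_assoc, hsk, mul_zero, norm_zero] at h1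
    exact norm_le_zero_iff.mp h1
  have hrw : r * w = 0 := by
    refine mul_eq_zero_of_pow_four_mul_eq_zero hr ?_
    rw [hrk]
    refine hw0 k ?_
    have := congrArg star hxk0
    rwa [star_mul, hk0.isSelfAdjoint.star_eq, star_zero] at this
  have hm0 : 0 ≤ h + w * star w := add_nonneg hh0 (mul_star_self_nonneg w)
  obtain ⟨s, hs0, hsm⟩ := exists_nonneg_pow_four hm0
  have hs := hs0.isSelfAdjoint
  have hrs : r * s = 0 := by
    have h1 : s * r = 0 := by
      refine mul_eq_zero_of_pow_four_mul_eq_zero hs ?_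
      have h2 := congrArg star (show r * (h + w * star w) = 0 by
        rw [mul_add, hrh, ← mul_assoc, hrw, zero_mul, add_zero])
      rwa [star_mul, hr.star_eq, hm0.isSelfAdjoint.star_eq, star_zero, ← hsm] at h2
    have := congrArg star h1
    rwa [star_mul, hr.star_eq, hs.star_eq, star_zero] at this
  obtain ⟨u, hu, -⟩ := exists_eq_mul_of_star_mul_self_le (c := star w) hs
    (by rw [star_star, hsm]; exact le_add_of_nonneg_left hh0)
  obtain ⟨r', s', hπr, hπs, hr'0, hs'0, hrs'⟩ := exists_orthogonal_lift π hπ hr0 hs0 hrs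
  have hr' := hr'0.isSelfAdjoint
  have hs' := hs'0.isSelfAdjoint
  have hsr' : s' * r' = 0 := by
    have := congrArg star hrs'
    rwa [star_mul, hr'.star_eq, hs'.star_eq, star_zero] at this
  obtain ⟨u', hπu⟩ := hπ u
  have hr'4 : IsSelfAdjoint (r' * r' * (r' * r')) := by
    simpa [hr'.star_eq] using IsSelfAdjoint.star_mul_self (r' * r')
  have hs'4 : IsSelfAdjoint (s' * s' * (s' * s')) := by
    simpa [hs'.star_eq] using IsSelfAdjoint.star_mul_self (s' * s')
  have hπh : π (s' * s' * (s' * s') - star (u' * s') * (u' * s')) = h := by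
    rw [map_sub, map_mul, map_mul, map_mul, map_star, map_mul, hπs, hπu, hsm, ← hu, star_star,
      add_sub_cancel_right]
  have hπx : π (r' * (u' * s')) = x := by
    rw [map_mul, map_mul, hπr, hπu, hπs, ← hu, ← hxw]
  have hπk : π (r' * r' * (r' * r')) = k := by
    rw [map_mul, map_mul, hπr, hrk]
  obtain ⟨h', x', k', h1, h2, h3, h4, h5⟩ := exists_lift_of_annihilator π (r := r')
    (h := s' * s' * (s' * s') - star (u' * s') * (u' * s')) (x := r' * (u' * s'))
    (k := r' * r' * (r' * r')) (by rwa [hπh, hπx, hπk]) (hs'4.sub (.star_mul_self _)) hr'4 hr'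
    (by simp only [sub_mul, mul_assoc, hsr', mul_zero, sub_zero])
    (by simp only [mul_assoc, hsr', mul_zero])
    (fun a ha ↦ by rw [star_mul, hr'.star_eq, mul_assoc, ha, mul_zero])
    (fun a ha ↦ by simp only [mul_assoc, ha, mul_zero])
  exact ⟨h', x', k', h1.trans hπh, h2.trans hπx, h3.trans hπk, h4, h5⟩
end

section
/- Let π : A → B be a surjective *-homomorphism of C*-algebras, and suppose h, x, k ∈ B satisfy hk = 0 and T(h,x,k) is a self-adjoint idempotent in M₂(B̃) (T(h,x,k)* = T(h,x,k) = T(h,x,k)²). Then there exist h', x', k' ∈ A with π(h') = h, π(x') = x, π(k') = k, such that h'k' = 0 and 0 ≤ T(h',x',k') ≤ 1 in M₂(Ã). (This expresses that the canonical surjection θ : 𝒫 → qℂ sending generators to generators is a projective *-homomorphism.) -/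
open scoped CStarAlgebra

section FunctionalCalculus

/-- A continuous function with values in `[0,1]`, fixing `0` and `1`. -/
noncomputable def rationalStep (t : ℝ) : ℝ := t * (t / (t ^ 2 + (1 - t) ^ 2))

lemma rationalStep_denom_pos (t : ℝ) : 0 < t ^ 2 + (1 - t) ^ 2 := by
  nlinarith [sq_nonneg (2 * t - 1)]

lemma continuous_div_rationalStep_denom {g : ℝ → ℝ} (hg : Continuous g) :
    Continuous fun t : ℝ ↦ g t / (t ^ 2 + (1 - t) ^ 2) :=
  hg.div (by fun_prop) fun t ↦ (rationalStep_denom_pos t).ne'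

lemma continuous_rationalStep : Continuous rationalStep :=
  continuous_id.mul (continuous_div_rationalStep_denom continuous_id)

lemma rationalStep_mem_Icc (t : ℝ) : rationalStep t ∈ Set.Icc (0 : ℝ) 1 := by
  have h := rationalStep_denom_pos t
  have e : rationalStep t = t ^ 2 / (t ^ 2 + (1 - t) ^ 2) := by
    rw [rationalStep]; ring
  rw [e]
  exact ⟨by positivity, by rw [div_le_one h]; nlinarith [sq_nonneg (1 - t)]⟩

lemma rationalStep_eq_one_add (t : ℝ) :
    rationalStep t = 1 + (t - 1) * ((1 - t) / (t ^ 2 + (1 - t) ^ 2)) := by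
  have h := (rationalStep_denom_pos t).ne'
  rw [rationalStep]
  field_simp
  ring

variable {D : Type*} [CStarAlgebra D]

/-- The positive contraction obtained by applying `rationalStep` to `T`. -/
noncomputable def stepCalculus (T : D) : D := cfc rationalStep T

lemma isSelfAdjoint_stepCalculus (T : D) : IsSelfAdjoint (stepCalculus T) :=
  cfc_predicate rationalStep T

lemma map_stepCalculus {E : Type*} [CStarAlgebra E] (φ : D →⋆ₐ[ℂ] E) {T : D}
    (hT : IsSelfAdjoint T) : φ (stepCalculus T) = stepCalculus (φ T) :=
  have hφT : IsSelfAdjoint (φ T) := hT.map φ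
  φ.map_cfc rationalStep T continuous_rationalStep.continuousOn (map_continuous φ)

lemma mul_stepCalculus_eq_zero {n T : D} (hT : IsSelfAdjoint T) (h : n * T = 0) :
    n * stepCalculus T = 0 := by
  have hg := continuous_div_rationalStep_denom continuous_id
  have e : stepCalculus T = T * cfc (fun t : ℝ ↦ t / (t ^ 2 + (1 - t) ^ 2)) T := by
    conv_rhs => enter [1]; rw [← cfc_id' ℝ T]
    exact cfc_mul _ _ T (by fun_prop) hg.continuousOn
  rw [e, ← mul_assoc, h, zero_mul]

lemma mul_stepCalculus_eq_self {n T : D} (hT : IsSelfAdjoint T) (h : n * T = n) :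
    n * stepCalculus T = n := by
  have hg := continuous_div_rationalStep_denom (g := fun t ↦ 1 - t) (by fun_prop)
  have e : stepCalculus T =
      1 + (T - 1) * cfc (fun t : ℝ ↦ (1 - t) / (t ^ 2 + (1 - t) ^ 2)) T := by
    have e1 : T - 1 = cfc (fun t : ℝ ↦ t - 1) T := by
      rw [cfc_sub (fun t : ℝ ↦ t) (fun _ ↦ 1) T, cfc_id' ℝ T, cfc_const_one ℝ T]
    rw [e1, ← cfc_mul _ _ T (by fun_prop) hg.continuousOn, ← cfc_const_one ℝ T,
      ← cfc_add T _ _ (by fun_prop) (by fun_prop)]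
    exact cfc_congr fun t _ ↦ rationalStep_eq_one_add t
  rw [e, mul_add, ← mul_assoc, mul_sub, h, mul_one, sub_self, zero_mul, add_zero]

lemma stepCalculus_of_isIdempotentElem {T : D} (hT : IsSelfAdjoint T) (h : T * T = T) :
    stepCalculus T = T := by
  have h1 := mul_stepCalculus_eq_self hT h
  have h0 := mul_stepCalculus_eq_zero (n := 1 - T) hT (by rw [sub_mul, h, one_mul, sub_self])
  rwa [sub_mul, one_mul, h1, sub_eq_zero] at h0

lemma spectrum_stepCalculus_subset {T : D} (hT : IsSelfAdjoint T) :
    spectrum ℂ (stepCalculus T) ⊆ Complex.ofReal '' Set.Icc (0 : ℝ) 1 := by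
  have hsa := isSelfAdjoint_stepCalculus T
  rw [← hsa.spectrumRestricts.algebraMap_image]
  refine Set.image_mono ?_
  rw [stepCalculus, cfc_map_spectrum rationalStep T hT continuous_rationalStep.continuousOn]
  rintro _ ⟨t, -, rfl⟩
  exact rationalStep_mem_Icc t

lemma mul_eq_zero_of_pow_two_pow_mul_eq_zero {a m : D} (ha : IsSelfAdjoint a) (n : ℕ)
    (h : a ^ 2 ^ n * m = 0) : a * m = 0 := by
  induction n with
  | zero => simpa using h
  | succ n ih =>
    refine ih ?_
    rw [← CStarRing.star_mul_self_eq_zero_iff, star_mul, (ha.pow _).star_eq, mul_assoc,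
      ← mul_assoc (a ^ 2 ^ n), ← pow_add, ← two_mul, ← pow_succ', h, mul_zero]

/-- A self-adjoint `s` factors as `r² w r²`, where `r = |s|^(1/8)`. -/
lemma exists_selfAdjoint_factorization {s : D} (hs : IsSelfAdjoint s) :
    ∃ r w : D, IsSelfAdjoint r ∧ IsSelfAdjoint w ∧ s = r * r * w * (r * r) ∧
      r ^ 2 ^ 4 = s * s ∧ (∀ b, Commute (s * s) b → Commute r b) ∧
      ∀ φ : D →⋆ₐ[ℂ] D, φ s = 0 → φ r = 0 ∧ φ w = 0 := by
  have hss : IsSelfAdjoint (s * s) := by simpa [hs.star_eq] using IsSelfAdjoint.star_mul_self s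
  set r : D := cfc (fun t : ℝ ↦ √√√√t) (s * s) with hr
  have hr' : r = cfc (fun t : ℝ ↦ √√√|t|) s := by
    have : s * s = cfc (fun t : ℝ ↦ t * t) s := by
      rw [cfc_mul (fun t : ℝ ↦ t) (fun t ↦ t) s, cfc_id' ℝ s]
    rw [hr, this, ← cfc_comp' (fun t : ℝ ↦ √√√√t) (fun t : ℝ ↦ t * t) s]
    simp only [Real.sqrt_mul_self_eq_abs]
  have hw : Continuous fun t : ℝ ↦ √t - √(-t) := by fun_prop
  refine ⟨r, cfc (fun t : ℝ ↦ √t - √(-t)) s, cfc_predicate _ _, cfc_predicate _ _, ?_, ?_, ?_, ?_⟩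
  · rw [hr', ← cfc_mul .., ← cfc_mul .., ← cfc_mul ..]
    conv_lhs => rw [← cfc_id' ℝ s]
    refine cfc_congr fun t _ ↦ ?_
    have h1 : √√√|t| * √√√|t| = √√|t| := Real.mul_self_sqrt (by positivity)
    have h2 : √√|t| * √√|t| = √|t| := Real.mul_self_sqrt (by positivity)
    have h3 : √|t| * (√t - √(-t)) = t := by
      rcases le_total 0 t with h | h
      · rw [abs_of_nonneg h, Real.sqrt_eq_zero_of_nonpos (neg_nonpos.2 h), sub_zero,
          Real.mul_self_sqrt h]
      · rw [abs_of_nonpos h, Real.sqrt_eq_zero_of_nonpos h, zero_sub, mul_neg,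
          Real.mul_self_sqrt (neg_nonneg.2 h), neg_neg]
    simp only [h1]
    rw [mul_right_comm, h2, h3]
  · rw [hr, ← cfc_pow ..]
    conv_rhs => rw [← cfc_id' ℝ (s * s)]
    refine cfc_congr fun t ht ↦ ?_
    have ht0 : 0 ≤ t := by
      have := spectrum_star_mul_self_nonneg (b := s)
      rw [hs.star_eq] at this
      exact this t ht
    have h1 : √√√√t ^ 2 = √√√t := Real.sq_sqrt (by positivity)
    have h2 : √√√t ^ 2 = √√t := Real.sq_sqrt (by positivity)
    have h3 : √√t ^ 2 = √t := Real.sq_sqrt (by positivity)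
    have h4 : √t ^ 2 = t := Real.sq_sqrt ht0
    calc √√√√t ^ 2 ^ 4 = (((√√√√t ^ 2) ^ 2) ^ 2) ^ 2 := by ring
      _ = t := by rw [h1, h2, h3, h4]
  · exact fun b hb ↦ hb.cfc_real _
  · intro φ hφ
    have key (f : ℝ → ℝ) (hf : Continuous f) (h0 : f 0 = 0) : φ (cfc f s) = 0 := by
      rw [StarAlgHom.map_cfc φ f s hf.continuousOn (map_continuous φ), hφ, cfc_apply_zero, h0, map_zero]
    exact ⟨hr' ▸ key _ (by fun_prop) (by simp), key _ hw (by simp)⟩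

end FunctionalCalculus

section Lifting

variable {A B : Type*} [NonUnitalCStarAlgebra A] [NonUnitalCStarAlgebra B]

lemma exists_isSelfAdjoint_lift {π : A →⋆ₙₐ[ℂ] B} (hπ : Function.Surjective π) {b : B}
    (hb : IsSelfAdjoint b) : ∃ a : A, IsSelfAdjoint a ∧ π a = b := by
  obtain ⟨a, rfl⟩ := hπ b
  have h2 : IsSelfAdjoint (2⁻¹ : ℂ) := by simp [isSelfAdjoint_iff]
  refine ⟨(2⁻¹ : ℂ) • (a + star a), h2.smul (IsSelfAdjoint.add_star_self a), ?_⟩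
  rw [map_smul, map_add, map_star, hb.star_eq, ← two_smul ℂ, smul_smul]
  norm_num

/-- Orthogonal elements of the form `p²`, `q²` with `p`, `q` self-adjoint lift to orthogonal
self-adjoint elements. -/
lemma exists_orthogonal_lift_s11 {π : A →⋆ₙₐ[ℂ] B} (hπ : Function.Surjective π) {p q : B}
    (hp : IsSelfAdjoint p) (hq : IsSelfAdjoint q) (hpq : p * q = 0) :
    ∃ p' q' : A, IsSelfAdjoint p' ∧ IsSelfAdjoint q' ∧ p' * q' = 0 ∧
      π p' = p * p ∧ π q' = q * q := by
  let := CStarAlgebra.spectralOrder B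
  have := CStarAlgebra.spectralOrderedRing B
  have hp0 : 0 ≤ p * p := by simpa [hp.star_eq] using star_mul_self_nonneg p
  have hq0 : 0 ≤ q * q := by simpa [hq.star_eq] using star_mul_self_nonneg q
  obtain ⟨a, ha, hπa⟩ := exists_isSelfAdjoint_lift hπ (hp0.isSelfAdjoint.sub hq0.isSelfAdjoint)
  obtain ⟨hpos, hneg⟩ := CFC.posPart_negPart_unique rfl
    (by rw [mul_assoc, ← mul_assoc p q, hpq, zero_mul, mul_zero]) hp0 hq0
  have hπa' : IsSelfAdjoint (π a) := ha.map π
  refine ⟨a⁺, a⁻, cfcₙ_predicate _ _, cfcₙ_predicate _ _, CFC.posPart_mul_negPart a, ?_, ?_⟩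
  · rw [← hpos, ← hπa, CFC.posPart_def, CFC.posPart_def,
      NonUnitalStarAlgHom.map_cfcₙ π _ a (by fun_prop) (by simp) (map_continuous π)]
  · rw [← hneg, ← hπa, CFC.negPart_def, CFC.negPart_def,
      NonUnitalStarAlgHom.map_cfcₙ π _ a (by fun_prop) (by simp) (map_continuous π)]

end Lifting

section Matrix

open Unitization

variable {A B : Type*} [NonUnitalCStarAlgebra A] [NonUnitalCStarAlgebra B]

/-- The entrywise extension of a *-homomorphism to `2 × 2` matrices over the unitizations. -/
noncomputable def matrixStarMap (π : A →⋆ₙₐ[ℂ] B) :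
    CStarMatrix (Fin 2) (Fin 2) (Unitization ℂ A) →⋆ₐ[ℂ]
      CStarMatrix (Fin 2) (Fin 2) (Unitization ℂ B) where
  toFun M := M.map (starMap π)
  map_zero' := by refine CStarMatrix.ext fun i j ↦ ?_; simp [-starMap_apply]
  map_one' := by refine CStarMatrix.ext fun i j ↦ ?_; simp [-starMap_apply, CStarMatrix.one_apply, apply_ite (starMap π)]
  map_add' M N := by refine CStarMatrix.ext fun i j ↦ ?_; simp [-starMap_apply]
  map_mul' M N := by refine CStarMatrix.ext fun i j ↦ ?_; simp [-starMap_apply, CStarMatrix.mul_apply]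
  map_star' M := by refine CStarMatrix.ext fun i j ↦ ?_; simp [-starMap_apply, CStarMatrix.star_apply, map_star]
  commutes' r := by refine CStarMatrix.ext fun i j ↦ ?_; simp [-starMap_apply, CStarMatrix.algebraMap_apply, apply_ite (starMap π), AlgHomClass.commutes]

@[simp]
lemma matrixStarMap_apply (π : A →⋆ₙₐ[ℂ] B) (M : CStarMatrix (Fin 2) (Fin 2) (Unitization ℂ A))
    (i j : Fin 2) : matrixStarMap π M i j = starMap π (M i j) := rfl

lemma starMap_zero_eq_inl (z : Unitization ℂ A) :
    starMap (0 : A →⋆ₙₐ[ℂ] B) z = inl z.fst := by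
  induction z using Unitization.ind with
  | inl_add_inr r a => simp [algebraMap_eq_inl]

lemma exists_eq_inr_of_starMap_zero {z : Unitization ℂ A}
    (h : starMap (0 : A →⋆ₙₐ[ℂ] A) z = 0) : ∃ a : A, z = a := by
  rw [starMap_zero_eq_inl] at h
  refine ⟨z.snd, Unitization.ext ?_ rfl⟩
  exact inl_injective (R := ℂ) (A := A) h

/-- If `T(h,x,k)` is a projection and `hk = 0`, then `h`, `x` and `k` factor through
squares of orthogonal self-adjoint elements. -/
lemma exists_orthogonal_factorization {h x k : B} (horth : h * k = 0)
    (hsa : IsSelfAdjoint (Tmat h x k)) (hidem : Tmat h x k * Tmat h x k = Tmat h x k) :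
    ∃ p q a y b : B, IsSelfAdjoint p ∧ IsSelfAdjoint q ∧ IsSelfAdjoint a ∧ IsSelfAdjoint b ∧
      p * q = 0 ∧ h = (p * p) * a * (p * p) ∧ x = (q * q) * y * (p * p) ∧
      k = (q * q) * b * (q * q) := by
  let := CStarAlgebra.spectralOrder (Unitization ℂ B)
  have := CStarAlgebra.spectralOrderedRing (Unitization ℂ B)
  let T : CStarMatrix (Fin 2) (Fin 2) (Unitization ℂ B) := CStarMatrix.ofMatrix (Tmat h x k)
  let P : CStarMatrix (Fin 2) (Fin 2) (Unitization ℂ B) := CStarMatrix.ofMatrix !![1, 0; 0, 0]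
  let W : CStarMatrix (Fin 2) (Fin 2) (Unitization ℂ B) := CStarMatrix.ofMatrix !![0, 1; 1, 0]
  have hT : IsSelfAdjoint T := hsa
  have hTT : T * T = T := hidem
  have hP : IsSelfAdjoint P := by
    refine CStarMatrix.ext fun i j ↦ ?_; fin_cases i <;> fin_cases j <;> simp [P, CStarMatrix.star_apply]
  have hW : IsSelfAdjoint W := by
    refine CStarMatrix.ext fun i j ↦ ?_; fin_cases i <;> fin_cases j <;> simp [W, CStarMatrix.star_apply]
  have hPP : P * P = P := by
    refine CStarMatrix.ext fun i j ↦ ?_; fin_cases i <;> fin_cases j <;>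
      simp [P, CStarMatrix.mul_apply, Fin.sum_univ_two]
  have h00 : T 0 0 = 1 - (h : Unitization ℂ B) := rfl
  have h01 : T 0 1 = star (x : Unitization ℂ B) := rfl
  have h10 : T 1 0 = (x : Unitization ℂ B) := rfl
  have h11 : T 1 1 = (k : Unitization ℂ B) := rfl
  have hh : IsSelfAdjoint h := by
    have := CStarMatrix.star_apply_of_isSelfAdjoint hT (i := 0) (j := 0)
    rw [h00, star_sub, star_one, sub_right_inj] at this
    exact .of_inr this
  have hk : IsSelfAdjoint k := .of_inr (CStarMatrix.star_apply_of_isSelfAdjoint hT (i := 1) (j := 1))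
  have hkh : k * h = 0 := by
    rw [← hh.star_eq, ← hk.star_eq, ← star_mul, horth, star_zero]
  have hs2 : (T - P) * (T - P) = CStarMatrix.ofMatrix !![(h : Unitization ℂ B), 0; 0, (k : Unitization ℂ B)] := by
    rw [sub_mul, mul_sub, mul_sub, hTT, hPP]
    refine CStarMatrix.ext fun i j ↦ ?_
    fin_cases i <;> fin_cases j <;>
      simp [P, CStarMatrix.mul_apply, Fin.sum_univ_two, h00, h01, h10, h11]
  have hcomm : Commute ((T - P) * (T - P)) P := by
    rw [hs2]
    refine CStarMatrix.ext fun i j ↦ ?_; fin_cases i <;> fin_cases j <;>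
      simp [P, CStarMatrix.mul_apply, Fin.sum_univ_two]
  have hEWE : (T - P) * (T - P) * (W * ((T - P) * (T - P))) = 0 := by
    rw [hs2]
    refine CStarMatrix.ext fun i j ↦ ?_; fin_cases i <;> fin_cases j <;>
      simp [W, CStarMatrix.mul_apply, Fin.sum_univ_two, ← inr_mul, horth, hkh]
  have hs0 : matrixStarMap (0 : B →⋆ₙₐ[ℂ] B) (T - P) = 0 := by
    refine CStarMatrix.ext fun i j ↦ ?_; fin_cases i <;> fin_cases j <;>
      simp [-starMap_apply, map_star, P, h00, h01, h10, h11]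
  obtain ⟨r, w, hr, hw, hs, hr16, hrc, hφ⟩ := exists_selfAdjoint_factorization (hT.sub hP)
  obtain ⟨hr0, hw0⟩ := hφ _ hs0
  have hrP := hrc P hcomm
  have hr01 : r 0 1 = 0 := by
    simpa [P, CStarMatrix.mul_apply, Fin.sum_univ_two] using (congrFun₂ hrP 0 1).symm
  have hr10 : r 1 0 = 0 := by
    simpa [P, CStarMatrix.mul_apply, Fin.sum_univ_two] using congrFun₂ hrP 1 0
  have hrWr : r * (W * r) = 0 := by
    rw [← hr16] at hEWE
    have h1 := mul_eq_zero_of_pow_two_pow_mul_eq_zero hr 4 hEWE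
    have h2 : r ^ 2 ^ 4 * (W * r) = 0 := by
      have := congrArg star h1
      rwa [star_mul, star_mul, hr.star_eq, (hr.pow _).star_eq, hW.star_eq, star_zero,
        mul_assoc] at this
    exact mul_eq_zero_of_pow_two_pow_mul_eq_zero hr 4 h2
  obtain ⟨p, hp⟩ := exists_eq_inr_of_starMap_zero (congrFun₂ hr0 0 0)
  obtain ⟨q, hq⟩ := exists_eq_inr_of_starMap_zero (congrFun₂ hr0 1 1)
  obtain ⟨a, ha⟩ := exists_eq_inr_of_starMap_zero (congrFun₂ hw0 0 0)
  obtain ⟨b, hb⟩ := exists_eq_inr_of_starMap_zero (congrFun₂ hw0 1 1)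
  obtain ⟨y, hy⟩ := exists_eq_inr_of_starMap_zero (congrFun₂ hw0 1 0)
  have hdiag {M : CStarMatrix (Fin 2) (Fin 2) (Unitization ℂ B)} (hM : IsSelfAdjoint M)
      {i : Fin 2} {c : B} (hc : M i i = c) : IsSelfAdjoint c :=
    .of_inr (hc ▸ CStarMatrix.star_apply_of_isSelfAdjoint hM (i := i) (j := i))
  refine ⟨p, q, -a, y, b, hdiag hr hp, hdiag hr hq, (hdiag hw ha).neg, hdiag hw hb, ?_, ?_, ?_, ?_⟩
  · have := congrFun₂ hrWr 0 1
    refine inr_injective (R := ℂ) ?_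
    simpa [W, CStarMatrix.mul_apply, Fin.sum_univ_two, hr01, hr10, hp, hq] using this
  · have := congrFun₂ hs 0 0
    refine inr_injective (R := ℂ) ?_
    simp [P, CStarMatrix.mul_apply, Fin.sum_univ_two, hr01, hr10, hp, h00, ha] at this
    simpa using congrArg Neg.neg this
  · have := congrFun₂ hs 1 0
    refine inr_injective (R := ℂ) ?_
    simpa [P, CStarMatrix.mul_apply, Fin.sum_univ_two, hr01, hr10, hp, hq, h10, hy] using this
  · have := congrFun₂ hs 1 1
    refine inr_injective (R := ℂ) ?_
    simpa [P, CStarMatrix.mul_apply, Fin.sum_univ_two, hr01, hr10, hp, hq, h11, hb] using this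

/-- Applying `rationalStep` to `T(pap, qyp, qbq)` with `p`, `q` orthogonal yields a positive
contraction whose diagonal entries are still orthogonal. -/
lemma exists_orthogonal_correction (π : A →⋆ₙₐ[ℂ] B) {p q a b : A} (hp : IsSelfAdjoint p)
    (hq : IsSelfAdjoint q) (hpq : p * q = 0) (ha : IsSelfAdjoint a) (y : A)
    (hb : IsSelfAdjoint b)
    (hidem : Tmat (π (p * a * p)) (π (q * y * p)) (π (q * b * q)) *
      Tmat (π (p * a * p)) (π (q * y * p)) (π (q * b * q)) =
      Tmat (π (p * a * p)) (π (q * y * p)) (π (q * b * q))) :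
    ∃ h x k : A, π h = π (p * a * p) ∧ π x = π (q * y * p) ∧ π k = π (q * b * q) ∧ h * k = 0 ∧
      IsPosUnitInterval (Tmat h x k) := by
  let := CStarAlgebra.spectralOrder (Unitization ℂ A)
  have := CStarAlgebra.spectralOrderedRing (Unitization ℂ A)
  let := CStarAlgebra.spectralOrder (Unitization ℂ B)
  have := CStarAlgebra.spectralOrderedRing (Unitization ℂ B)
  have hqp : q * p = 0 := by
    rw [← hq.star_eq, ← hp.star_eq, ← star_mul, hpq, star_zero]
  let T : CStarMatrix (Fin 2) (Fin 2) (Unitization ℂ A) :=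
    CStarMatrix.ofMatrix (Tmat (p * a * p) (q * y * p) (q * b * q))
  let P : CStarMatrix (Fin 2) (Fin 2) (Unitization ℂ A) := CStarMatrix.ofMatrix !![1, 0; 0, 0]
  have hp' : star (p : Unitization ℂ A) = p := by rw [← inr_star, hp.star_eq]
  have hq' : star (q : Unitization ℂ A) = q := by rw [← inr_star, hq.star_eq]
  have ha' : star (a : Unitization ℂ A) = a := by rw [← inr_star, ha.star_eq]
  have hb' : star (b : Unitization ℂ A) = b := by rw [← inr_star, hb.star_eq]
  have hT : IsSelfAdjoint T := by
    refine CStarMatrix.ext fun i j ↦ ?_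
    fin_cases i <;> fin_cases j <;>
      simp [T, Tmat, CStarMatrix.star_apply, hp', hq', ha', hb',
        mul_assoc]
  have hP : IsSelfAdjoint P := by
    refine CStarMatrix.ext fun i j ↦ ?_
    fin_cases i <;> fin_cases j <;> simp [P, CStarMatrix.star_apply]
  have hPP : P * P = P := by
    refine CStarMatrix.ext fun i j ↦ ?_
    fin_cases i <;> fin_cases j <;> simp [P, CStarMatrix.mul_apply, Fin.sum_univ_two]
  have hTP : matrixStarMap (0 : A →⋆ₙₐ[ℂ] A) T = P := by
    refine CStarMatrix.ext fun i j ↦ ?_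
    fin_cases i <;> fin_cases j <;>
      simp [-starMap_apply, T, Tmat, P, map_star]
  have hπT : matrixStarMap π T =
      CStarMatrix.ofMatrix (Tmat (π (p * a * p)) (π (q * y * p)) (π (q * b * q))) := by
    refine CStarMatrix.ext fun i j ↦ ?_
    fin_cases i <;> fin_cases j <;> simp [-starMap_apply, T, Tmat, map_star]
  let S := stepCalculus T
  have hS : IsSelfAdjoint S := isSelfAdjoint_stepCalculus T
  have hSP : matrixStarMap (0 : A →⋆ₙₐ[ℂ] A) S = P := by
    rw [map_stepCalculus _ hT, hTP]
    exact stepCalculus_of_isIdempotentElem hP hPP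
  have hπS : matrixStarMap π S = matrixStarMap π T := by
    rw [map_stepCalculus _ hT]
    exact stepCalculus_of_isIdempotentElem (hT.map _) (hπT ▸ hidem)
  obtain ⟨h, hh⟩ : ∃ h : A, 1 - S 0 0 = h := exists_eq_inr_of_starMap_zero <| by
    have := congrFun₂ hSP 0 0
    rw [matrixStarMap_apply] at this
    rw [map_sub, this]
    simp [P]
  obtain ⟨x, hx⟩ : ∃ x : A, S 1 0 = x := exists_eq_inr_of_starMap_zero (congrFun₂ hSP 1 0)
  obtain ⟨k, hk⟩ : ∃ k : A, S 1 1 = k := exists_eq_inr_of_starMap_zero (congrFun₂ hSP 1 1)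
  have hST : S = CStarMatrix.ofMatrix (Tmat h x k) := by
    refine CStarMatrix.ext fun i j ↦ ?_
    fin_cases i <;> fin_cases j
    · simp [Tmat, ← hh]
    · rw [← CStarMatrix.star_apply_of_isSelfAdjoint hS]
      simp [Tmat, hx]
    · simp [Tmat, hx]
    · simp [Tmat, hk]
  rw [hπT, hST] at hπS
  have hqh : q * h = 0 := by
    let N : CStarMatrix (Fin 2) (Fin 2) (Unitization ℂ A) :=
      CStarMatrix.ofMatrix !![(q : Unitization ℂ A), 0; 0, 0]
    have hNT : N * T = N := by
      refine CStarMatrix.ext fun i j ↦ ?_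
      fin_cases i <;> fin_cases j <;>
        simp [N, T, Tmat, CStarMatrix.mul_apply, Fin.sum_univ_two, mul_sub, ← inr_mul, ← inr_star,
          ← mul_assoc, hqp, hp.star_eq]
    have hNS : N * S = N := mul_stepCalculus_eq_self hT hNT
    have := congrFun₂ hNS 0 0
    rw [hST] at this
    refine inr_injective (R := ℂ) ?_
    simpa [N, Tmat, CStarMatrix.mul_apply, Fin.sum_univ_two, mul_sub] using this
  have hsa : IsSelfAdjoint h := by
    refine .of_inr (R := ℂ) ?_
    rw [← hh]
    exact (IsSelfAdjoint.one _).sub (CStarMatrix.star_apply_of_isSelfAdjoint hS)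
  have hhq : h * q = 0 := by
    rw [← hsa.star_eq, ← hq.star_eq, ← star_mul, hqh, star_zero]
  have hhk : h * k = 0 := by
    let N : CStarMatrix (Fin 2) (Fin 2) (Unitization ℂ A) :=
      CStarMatrix.ofMatrix !![0, 0; 0, (h : Unitization ℂ A)]
    have hNT : N * T = 0 := by
      refine CStarMatrix.ext fun i j ↦ ?_
      fin_cases i <;> fin_cases j <;>
        simp [N, T, Tmat, CStarMatrix.mul_apply, Fin.sum_univ_two, ← inr_mul, ← mul_assoc, hhq]
    have hNS : N * S = 0 := mul_stepCalculus_eq_zero hT hNT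
    have := congrFun₂ hNS 1 1
    rw [hST] at this
    refine inr_injective (R := ℂ) ?_
    simpa [N, Tmat, CStarMatrix.mul_apply, Fin.sum_univ_two] using this
  refine ⟨h, x, k, ?_, ?_, ?_, hhk, ?_, ?_⟩
  · have := congrFun₂ hπS 0 0
    exact inr_injective (R := ℂ) (by simpa [-starMap_apply, Tmat] using this)
  · have := congrFun₂ hπS 1 0
    exact inr_injective (R := ℂ) (by simpa [-starMap_apply, Tmat] using this)
  · have := congrFun₂ hπS 1 1
    exact inr_injective (R := ℂ) (by simpa [-starMap_apply, Tmat] using this)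
  · change IsSelfAdjoint (CStarMatrix.ofMatrix (Tmat h x k))
    exact hST ▸ hS
  · rw [← AlgEquiv.spectrum_eq (CStarMatrix.ofMatrixStarAlgEquiv (n := Fin 2)
      (A := Unitization ℂ A)), ← CStarMatrix.ofMatrix_eq_ofMatrixStarAlgEquiv, ← hST]
    exact spectrum_stepCalculus_subset hT

end Matrix

/-- Given a surjective *-homomorphism `π : A → B` and `h, x, k ∈ B` with
`hk = 0` and `T(h,x,k)` a self-adjoint idempotent in `M₂(B̃)`, there are lifts
`h', x', k' ∈ A` with `h'k' = 0` and `0 ≤ T(h',x',k') ≤ 1`: the canonical surjection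
`θ : 𝒫 → qℂ` is a projective *-homomorphism. -/
theorem stmt11 {A B : Type*} [NonUnitalCStarAlgebra A] [NonUnitalCStarAlgebra B]
    (π : A →⋆ₙₐ[ℂ] B) (hπ : Function.Surjective π) (h x k : B)
    (horth : h * k = 0) (hsa : IsSelfAdjoint (Tmat h x k))
    (hidem : Tmat h x k * Tmat h x k = Tmat h x k) :
    ∃ h' x' k' : A, π h' = h ∧ π x' = x ∧ π k' = k ∧ h' * k' = 0 ∧
      IsPosUnitInterval (Tmat h' x' k') := by
  obtain ⟨p₀, q₀, a₀, y₀, b₀, hp₀, hq₀, ha₀, hb₀, hpq₀, rfl, rfl, rfl⟩ :=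
    exists_orthogonal_factorization horth hsa hidem
  obtain ⟨p, q, hp, hq, hpq, hπp, hπq⟩ := exists_orthogonal_lift_s11 hπ hp₀ hq₀ hpq₀
  obtain ⟨a, ha, rfl⟩ := exists_isSelfAdjoint_lift hπ ha₀
  obtain ⟨b, hb, rfl⟩ := exists_isSelfAdjoint_lift hπ hb₀
  obtain ⟨y, rfl⟩ := hπ y₀
  obtain ⟨h', x', k', hh', hx', hk', hzero, hpos⟩ :=
    exists_orthogonal_correction π hp hq hpq ha y hb (by simpa [hπp, hπq] using hidem)
  exact ⟨h', x', k', by simp [hh', hπp], by simp [hx', hπp, hπq], by simp [hk', hπq], hzero, hpos⟩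
end

section
/- Let A be a C*-algebra, let I₁ ⊆ I₂ ⊆ I₃ ⊆ ⋯ be an increasing sequence of closed two-sided ideals of A, and let I be the closure of their union. Suppose h, x, k ∈ A with h* = h and k* = k are such that the qℂ relations hold modulo I: hk ∈ I, h² + x*x − h ∈ I, k² + xx* − k ∈ I, and kx − xh ∈ I. Then there exist n ∈ ℕ and h', x', k' ∈ A with h'* = h', k'* = k', such that the qℂ relations hold modulo Iₙ: h'k' ∈ Iₙ, h'² + x'*x' − h' ∈ Iₙ, k'² + x'x'* − k' ∈ Iₙ, k'x' − x'h' ∈ Iₙ, and such that h − h' ∈ I, x − x' ∈ I, and k − k' ∈ I. (This expresses the semiprojectivity of the C*-algebra qℂ.) -/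
open Filter Topology Polynomial

universe u

/-- A continuous function is a limit of polynomials, uniformly enough to approximate the functional
calculus of all self-adjoint elements of norm at most `r` at once. -/
theorem exists_polynomial_tendsto_cfc {f : ℝ → ℝ} (hf : Continuous f) (r : ℝ) :
    ∃ q : ℕ → ℝ[X], ∀ {B : Type u} [CStarAlgebra B] (a : B), IsSelfAdjoint a → ‖a‖ ≤ r →
      Tendsto (fun n => aeval a (q n)) atTop (𝓝 (cfc f a)) := by
  choose q hq using fun n : ℕ => exists_polynomial_near_of_continuousOn (-r) r f hf.continuousOn
    (1 / ((n : ℝ) + 1)) (by positivity)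
  refine ⟨q, ?_⟩
  intro B _ a ha har
  rcases subsingleton_or_nontrivial B with _ | _
  · simp only [Subsingleton.elim _ (0 : B), tendsto_const_nhds_iff]
  rw [tendsto_iff_norm_sub_tendsto_zero]
  refine squeeze_zero (fun _ => norm_nonneg _) (fun n => ?_)
    tendsto_one_div_add_atTop_nhds_zero_nat
  rw [← cfc_polynomial (q n) a ha, ← cfc_sub _ _ a (q n).continuous.continuousOn hf.continuousOn]
  refine norm_cfc_le (by positivity) fun x hx => ?_
  have hx' : ‖x‖ ≤ r := (spectrum.norm_le_norm_of_mem hx).trans har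
  exact (hq n x (abs_le.mp hx')).le

/-- If `a - b` lies in a closed subspace that is stable under multiplication by `a` on the left and
by `b` on the right, then so does `f a - f b`. -/
theorem cfc_sub_cfc_mem {B : Type*} [CStarAlgebra B] (W : Submodule ℝ B)
    (hW : IsClosed (W : Set B)) {a b : B} (ha : IsSelfAdjoint a) (hb : IsSelfAdjoint b)
    (hab : a - b ∈ W) (hl : ∀ w ∈ W, a * w ∈ W) (hr : ∀ w ∈ W, w * b ∈ W)
    {f : ℝ → ℝ} (hf : Continuous f) : cfc f a - cfc f b ∈ W := by
  obtain ⟨q, hq⟩ := exists_polynomial_tendsto_cfc hf (max ‖a‖ ‖b‖)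
  refine hW.mem_of_tendsto ((hq a ha (le_max_left _ _)).sub (hq b hb (le_max_right _ _)))
    (Eventually.of_forall fun n => ?_)
  induction q n using Polynomial.induction_on' with
  | add p p' hp hp' =>
    rw [map_add, map_add, add_sub_add_comm]
    exact W.add_mem hp hp'
  | monomial n c =>
    simp only [aeval_monomial, ← Algebra.smul_def, ← smul_sub]
    refine W.smul_mem c ?_
    induction n with
    | zero => simp
    | succ n ih =>
      have h1 : a ^ (n + 1) - b ^ (n + 1) = a * (a ^ n - b ^ n) + (a - b) * b ^ n := by
        rw [pow_succ', pow_succ']; noncomm_ring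
      rw [h1]
      refine W.add_mem (hl _ ih) ?_
      clear ih h1
      induction n with
      | zero => simpa using hab
      | succ n ih => rw [pow_succ, ← mul_assoc]; exact hr _ ih

theorem mul_cfc_eq_zero {B : Type*} [CStarAlgebra B] {n a : B} (ha : IsSelfAdjoint a)
    (h : n * a = 0) {f : ℝ → ℝ} (hf : Continuous f) (hf0 : f 0 = 0) : n * cfc f a = 0 := by
  have := cfc_sub_cfc_mem (LinearMap.ker (LinearMap.mulLeft ℝ n))
    (isClosed_singleton.preimage (continuous_const_mul n)) ha (IsSelfAdjoint.zero B)
    (by simpa using h) (fun w _ => by simp [← mul_assoc, h]) (fun w _ => by simp) hf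
  simpa [cfc_apply_zero, hf0] using this

theorem cfc_mul_eq_zero {B : Type*} [CStarAlgebra B] {n a : B} (ha : IsSelfAdjoint a)
    (h : a * n = 0) {f : ℝ → ℝ} (hf : Continuous f) (hf0 : f 0 = 0) : cfc f a * n = 0 := by
  have h1 : star n * a = 0 := by rw [← ha.star_eq, ← star_mul, h, star_zero]
  have h2 := mul_cfc_eq_zero ha h1 hf hf0
  rw [← star_star (cfc f a * n), star_mul, (cfc_predicate f a).star_eq, h2, star_zero]

/-- Elements that are congruent modulo a closed two-sided ideal have congruent images under the
functional calculus. -/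
theorem cfc_sub_cfc_mem_ideal {B : Type*} [CStarAlgebra B] (J : Ideal B) [J.IsTwoSided]
    (hJ : IsClosed (J : Set B)) {a b : B} (ha : IsSelfAdjoint a) (hb : IsSelfAdjoint b)
    (hab : a - b ∈ J) {f : ℝ → ℝ} (hf : Continuous f) : cfc f a - cfc f b ∈ J :=
  cfc_sub_cfc_mem (J.restrictScalars ℝ) hJ ha hb hab (fun _ hw => J.mul_mem_left _ hw)
    (fun _ hw => J.mul_mem_right _ hw) hf

section Matrix

/-- The C⋆-algebra of `2 × 2` matrices over a unital C⋆-algebra. -/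
def TwoByTwo (B : Type*) := CStarMatrix (Fin 2) (Fin 2) B

namespace TwoByTwo

variable {B : Type u}

/-- The entries of a matrix. -/
def entry (M : TwoByTwo B) (i j : Fin 2) : B := (M : CStarMatrix (Fin 2) (Fin 2) B) i j

/-- The matrix with given entries. -/
def of (E : Fin 2 → Fin 2 → B) : TwoByTwo B := CStarMatrix.ofMatrix E

@[simp] theorem entry_of (E : Fin 2 → Fin 2 → B) (i j : Fin 2) : (of E).entry i j = E i j := rfl

theorem ext_entry {M N : TwoByTwo B} (h : ∀ i j, M.entry i j = N.entry i j) : M = N :=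
  CStarMatrix.ext h

variable [CStarAlgebra B]

noncomputable instance : CStarAlgebra (TwoByTwo B) :=
  letI := CStarAlgebra.spectralOrder B
  letI := CStarAlgebra.spectralOrderedRing B
  inferInstanceAs (CStarAlgebra (CStarMatrix (Fin 2) (Fin 2) B))

@[simp] theorem entry_add (M N : TwoByTwo B) (i j : Fin 2) :
    (M + N).entry i j = M.entry i j + N.entry i j := rfl

@[simp] theorem entry_sub (M N : TwoByTwo B) (i j : Fin 2) :
    (M - N).entry i j = M.entry i j - N.entry i j := rfl

@[simp] theorem entry_zero (i j : Fin 2) : (0 : TwoByTwo B).entry i j = 0 := rfl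

theorem entry_one (i j : Fin 2) : (1 : TwoByTwo B).entry i j = if i = j then 1 else 0 := rfl

@[simp] theorem entry_smul (r : ℝ) (M : TwoByTwo B) (i j : Fin 2) :
    (r • M).entry i j = r • M.entry i j := rfl

@[simp] theorem entry_star (M : TwoByTwo B) (i j : Fin 2) :
    (star M).entry i j = star (M.entry j i) := rfl

@[simp] theorem entry_mul (M N : TwoByTwo B) (i j : Fin 2) :
    (M * N).entry i j = M.entry i 0 * N.entry 0 j + M.entry i 1 * N.entry 1 j :=
  (CStarMatrix.mul_apply (M := M) (N := N)).trans (Fin.sum_univ_two _)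

theorem continuous_entry (i j : Fin 2) : Continuous fun M : TwoByTwo B => M.entry i j :=
  (continuous_apply j).comp (continuous_apply i)

theorem tendsto_of_entry {M : ℕ → TwoByTwo B} {N : TwoByTwo B}
    (h : ∀ i j, Tendsto (fun n => (M n).entry i j) atTop (𝓝 (N.entry i j))) :
    Tendsto M atTop (𝓝 N) :=
  tendsto_pi_nhds.mpr fun i => tendsto_pi_nhds.mpr fun j => h i j

/-- The `2 × 2` matrices whose entries lie in prescribed subspaces. -/
def submodule (E : Fin 2 → Fin 2 → Submodule ℝ B) : Submodule ℝ (TwoByTwo B) where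
  carrier := {M | ∀ i j, M.entry i j ∈ E i j}
  add_mem' hM hN i j := (E i j).add_mem (hM i j) (hN i j)
  zero_mem' i j := (E i j).zero_mem
  smul_mem' c _ hM i j := (E i j).smul_mem c (hM i j)

theorem mem_submodule {E : Fin 2 → Fin 2 → Submodule ℝ B} {M : TwoByTwo B} :
    M ∈ submodule E ↔ ∀ i j, M.entry i j ∈ E i j := Iff.rfl

theorem isClosed_submodule {E : Fin 2 → Fin 2 → Submodule ℝ B}
    (hE : ∀ i j, IsClosed (E i j : Set B)) : IsClosed (submodule E : Set (TwoByTwo B)) := by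
  have : (submodule E : Set (TwoByTwo B)) =
      ⋂ i, ⋂ j, (fun M : TwoByTwo B => M.entry i j) ⁻¹' (E i j : Set B) := by
    ext; simp [mem_submodule]
  rw [this]
  exact isClosed_iInter fun i => isClosed_iInter fun j => (hE i j).preimage (continuous_entry i j)

theorem aeval_diagonal (b c : B) (p : ℝ[X]) :
    aeval (of ![![b, 0], ![0, c]]) p = of ![![aeval b p, 0], ![0, aeval c p]] := by
  induction p using Polynomial.induction_on' with
  | add p p' hp hp' =>
    rw [map_add, hp, hp']
    refine ext_entry fun i j => ?_
    fin_cases i <;> fin_cases j <;> simp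
  | monomial n r =>
    simp only [aeval_monomial, ← Algebra.smul_def]
    induction n with
    | zero =>
      refine ext_entry fun i j => ?_
      fin_cases i <;> fin_cases j <;> simp [entry_one]
    | succ n ih =>
      rw [pow_succ, ← smul_mul_assoc, ih]
      refine ext_entry fun i j => ?_
      fin_cases i <;> fin_cases j <;> simp [pow_succ]

theorem cfc_diagonal {b c : B} (hb : IsSelfAdjoint b) (hc : IsSelfAdjoint c)
    {f : ℝ → ℝ} (hf : Continuous f) :
    cfc f (of ![![b, 0], ![0, c]]) = of ![![cfc f b, 0], ![0, cfc f c]] := by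
  have hDsa : IsSelfAdjoint (of ![![b, 0], ![0, c]]) := by
    refine ext_entry fun i j => ?_
    fin_cases i <;> fin_cases j <;> simp [hb.star_eq, hc.star_eq]
  obtain ⟨q, hq⟩ := exists_polynomial_tendsto_cfc hf
    (max ‖of ![![b, 0], ![0, c]]‖ (max ‖b‖ ‖c‖))
  have h1 := hq _ hDsa (le_max_left _ _)
  have h2 := hq b hb ((le_max_left _ _).trans (le_max_right _ _))
  have h3 := hq c hc ((le_max_right _ _).trans (le_max_right _ _))
  refine tendsto_nhds_unique h1 (tendsto_of_entry fun i j => ?_)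
  simp only [aeval_diagonal]
  fin_cases i <;> fin_cases j
  · simpa using h2
  · simp
  · simp
  · simpa using h3

end TwoByTwo

end Matrix

/-- The continuous extension by zero of the fifth root on `[0, ∞)`. -/
noncomputable def fifthRoot (t : ℝ) : ℝ := max t 0 ^ (1 / 5 : ℝ)

theorem continuous_fifthRoot : Continuous fifthRoot :=
  (continuous_id.max continuous_const).rpow_const fun _ => Or.inr (by norm_num)

@[simp] theorem fifthRoot_zero : fifthRoot 0 = 0 := by
  simp [fifthRoot]

theorem fifthRoot_of_nonpos {t : ℝ} (ht : t ≤ 0) : fifthRoot t = 0 := by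
  simp [fifthRoot, max_eq_right ht]

theorem fifthRoot_pow {s : ℝ} (hs : 0 ≤ s) : fifthRoot (s ^ 5) = s := by
  rw [fifthRoot, max_eq_left (pow_nonneg hs 5)]
  simpa using Real.pow_rpow_inv_natCast hs (n := 5) (by norm_num)

theorem fifthRoot_sq_mul_sub_mul (t : ℝ) :
    fifthRoot (t ^ 2) * (fifthRoot t - fifthRoot (-t)) * fifthRoot (t ^ 2) = t := by
  have key : ∀ s : ℝ, 0 ≤ s → fifthRoot ((s ^ 5) ^ 2) = s ^ 2 := fun s hs => by
    rw [← pow_mul, mul_comm, pow_mul, fifthRoot_pow (sq_nonneg s)]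
  have root : ∀ t : ℝ, 0 ≤ t → ∃ s, 0 ≤ s ∧ t = s ^ 5 := fun t ht =>
    ⟨t ^ ((5 : ℕ) : ℝ)⁻¹, Real.rpow_nonneg ht _,
      (Real.rpow_inv_natCast_pow ht (by norm_num)).symm⟩
  rcases le_total 0 t with ht | ht
  · obtain ⟨s, hs, rfl⟩ := root t ht
    rw [key s hs, fifthRoot_pow hs, fifthRoot_of_nonpos (neg_nonpos.mpr ht)]
    ring
  · obtain ⟨s, hs, hst⟩ := root (-t) (neg_nonneg.mpr ht)
    rw [← neg_sq, hst, key s hs, fifthRoot_pow hs, fifthRoot_of_nonpos ht]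
    linear_combination hst

open TwoByTwo in
/-- Every element is a multiple of the fifth roots of `x * star x` and `star x * x`. -/
theorem exists_eq_cfc_fifthRoot_mul {B : Type*} [CStarAlgebra B] (x : B) :
    ∃ v : B, x = cfc fifthRoot (x * star x) * v * cfc fifthRoot (star x * x) := by
  set a : TwoByTwo B := of ![![0, star x], ![x, 0]] with ha
  have hasa : IsSelfAdjoint a := by
    refine ext_entry fun i j => ?_
    fin_cases i <;> fin_cases j <;> simp [ha]
  have haa : a ^ 2 = of ![![star x * x, 0], ![0, x * star x]] := by
    refine ext_entry fun i j => ?_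
    fin_cases i <;> fin_cases j <;> simp [ha, pow_two]
  set f : ℝ → ℝ := fun t => fifthRoot t - fifthRoot (-t)
  have hf : Continuous f :=
    continuous_fifthRoot.sub (continuous_fifthRoot.comp continuous_neg)
  have hft : ∀ t, fifthRoot (t ^ 2) * f t * fifthRoot (t ^ 2) = t := fifthRoot_sq_mul_sub_mul
  have hg : Continuous fun t : ℝ => fifthRoot (t ^ 2) :=
    continuous_fifthRoot.comp (continuous_pow 2)
  have h1 : cfc fifthRoot (a ^ 2) * cfc f a * cfc fifthRoot (a ^ 2) = a := by
    rw [← cfc_comp_pow fifthRoot 2 a (continuous_fifthRoot.continuousOn) hasa,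
      ← cfc_mul _ _ a hg.continuousOn hf.continuousOn,
      ← cfc_mul (fun t => fifthRoot (t ^ 2) * f t) _ a (hg.mul hf).continuousOn hg.continuousOn]
    simp only [hft]
    exact cfc_id' ℝ a
  rw [haa, cfc_diagonal (.star_mul_self x) (.mul_star_self x) continuous_fifthRoot] at h1
  refine ⟨(cfc f a).entry 1 0, ?_⟩
  simpa [ha] using (congrArg (fun M => entry M 1 0) h1).symm

section Ideal

variable {B : Type*} [CStarAlgebra B] (J : Ideal B) [J.IsTwoSided]

theorem cfc_mem_ideal (hJ : IsClosed (J : Set B)) {a : B} (ha : IsSelfAdjoint a) (haJ : a ∈ J)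
    {f : ℝ → ℝ} (hf : Continuous f) (hf0 : f 0 = 0) : cfc f a ∈ J := by
  simpa [cfc_apply_zero, hf0] using
    cfc_sub_cfc_mem_ideal J hJ ha (IsSelfAdjoint.zero B) (by simpa using haJ) hf

theorem star_mem_ideal (hJ : IsClosed (J : Set B)) {a : B} (ha : a ∈ J) : star a ∈ J := by
  obtain ⟨v, hv⟩ := exists_eq_cfc_fifthRoot_mul a
  have hp : cfc fifthRoot (a * star a) ∈ J :=
    cfc_mem_ideal J hJ (.mul_star_self a) (J.mul_mem_right _ ha) continuous_fifthRoot
      fifthRoot_zero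
  rw [hv, star_mul, star_mul, (cfc_predicate fifthRoot (a * star a)).star_eq]
  exact J.mul_mem_left _ (J.mul_mem_left _ hp)

/-- Positive elements that are orthogonal modulo a closed ideal are congruent to self-adjoint
elements that are orthogonal. -/
theorem exists_mul_eq_zero_of_mul_mem [PartialOrder B] [StarOrderedRing B]
    (hJ : IsClosed (J : Set B)) {h k : B} (hh : 0 ≤ h) (hk : 0 ≤ k) (hhk : h * k ∈ J) :
    ∃ h' k' : B, IsSelfAdjoint h' ∧ IsSelfAdjoint k' ∧ h' * k' = 0 ∧ h - h' ∈ J ∧ k - k' ∈ J := by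
  have hsa := hh.isSelfAdjoint
  have ksa := hk.isSelfAdjoint
  have hkh : k * h ∈ J := by
    simpa [hsa.star_eq, ksa.star_eq] using star_mem_ideal J hJ hhk
  have dsa : IsSelfAdjoint (h - k) := hsa.sub ksa
  have esa : IsSelfAdjoint (h + k) := hsa.add ksa
  set m := cfc Real.sqrt ((h - k) ^ 2) with hm
  have msa : IsSelfAdjoint m := cfc_predicate _ _
  have hme : m - (h + k) ∈ J := by
    have he : cfc Real.sqrt ((h + k) ^ 2) = h + k := by
      rw [← cfc_comp_pow Real.sqrt 2 (h + k) Real.continuous_sqrt.continuousOn esa]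
      conv_rhs => rw [← cfc_id' ℝ (h + k)]
      exact cfc_congr fun x hx => Real.sqrt_sq (spectrum_nonneg_of_nonneg (add_nonneg hh hk) hx)
    rw [← he]
    refine cfc_sub_cfc_mem_ideal J hJ (dsa.pow 2) (esa.pow 2) ?_ Real.continuous_sqrt
    have : (h - k) ^ 2 - (h + k) ^ 2 = -(2 * (h * k) + 2 * (k * h)) := by noncomm_ring
    rw [this]
    exact J.neg_mem (J.add_mem (J.mul_mem_left _ hhk) (J.mul_mem_left _ hkh))
  have hmabs : m = cfc (fun t : ℝ => |t|) (h - k) := by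
    rw [hm, ← cfc_comp_pow Real.sqrt 2 (h - k) Real.continuous_sqrt.continuousOn dsa]
    simp only [Real.sqrt_sq_eq_abs]
  have hmm : m * m = (h - k) * (h - k) := by
    rw [hmabs, ← cfc_mul _ _ (h - k) continuous_abs.continuousOn continuous_abs.continuousOn]
    simp only [abs_mul_abs_self]
    rw [cfc_mul (fun t : ℝ => t) _ (h - k), cfc_id' ℝ (h - k)]
  have hcomm : m * (h - k) = (h - k) * m := by
    rw [hmabs]
    exact (Commute.refl (h - k)).cfc (by rw [dsa.star_eq]) _
  refine ⟨(1 / 2 : ℝ) • (m + (h - k)), (1 / 2 : ℝ) • (m - (h - k)),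
    IsSelfAdjoint.smul (.all _) (msa.add dsa), IsSelfAdjoint.smul (.all _) (msa.sub dsa),
    ?_, ?_, ?_⟩
  · rw [smul_mul_smul_comm, add_mul, mul_sub m m, mul_sub (h - k) m, hmm, hcomm]
    simp
  · convert J.neg_mem (J.smul_of_tower_mem (1 / 2 : ℝ) hme) using 1
    module
  · convert J.neg_mem (J.smul_of_tower_mem (1 / 2 : ℝ) hme) using 1
    module

end Ideal

/-- A continuous function equal to `1 / √(1 + 4 u)` for `u ≥ -3 / 16`. -/
noncomputable def invSqrt (u : ℝ) : ℝ := (max (1 / 2) √(1 + 4 * u))⁻¹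

theorem continuous_invSqrt : Continuous invSqrt := by
  unfold invSqrt
  refine Continuous.inv₀ (by fun_prop) fun u => ?_
  positivity

@[simp] theorem invSqrt_zero : invSqrt 0 = 1 := by
  norm_num [invSqrt]

theorem invSqrt_mul_self {u : ℝ} (hu : -(3 / 16) ≤ u) :
    (u + 1 / 4) * (invSqrt u * invSqrt u) - 1 / 4 = 0 := by
  have h1 : (1 / 2 : ℝ) ≤ √(1 + 4 * u) := Real.le_sqrt_of_sq_le (by linarith)
  have h2 : (1 + 4 * u) ≠ 0 := by linarith
  rw [invSqrt, max_eq_right h1, ← mul_inv, Real.mul_self_sqrt (by linarith)]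
  have h3 : u + 1 / 4 = (1 + 4 * u) / 4 := by ring
  rw [h3, div_mul_eq_mul_div, mul_inv_cancel₀ h2, sub_self]

section Perturbation

variable {C : Type*} [CStarAlgebra C]

/-- For self-adjoint `T`, this is the spectral projection of `T` for `[1 / 2, ∞)` as soon as `T` is
close enough to being a projection. -/
noncomputable def nearProjection (T : C) : C :=
  algebraMap ℝ C (1 / 2) + (T - algebraMap ℝ C (1 / 2)) * cfc invSqrt (T * T - T)

theorem nearProjection_sub_self (T : C) :
    nearProjection T - T = (T - algebraMap ℝ C (1 / 2)) * (cfc invSqrt (T * T - T) - 1) := by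
  rw [nearProjection]
  noncomm_ring

theorem commute_cfc_mul_self_sub_self {T : C} (hT : IsSelfAdjoint T) :
    Commute (cfc invSqrt (T * T - T)) (T - algebraMap ℝ C (1 / 2)) := by
  have h1 : Commute (T * T - T) (T - algebraMap ℝ C (1 / 2)) :=
    (((Commute.refl T).mul_left (Commute.refl T)).sub_left (Commute.refl T)).sub_right
      (Algebra.commutes _ _).symm
  refine h1.cfc ?_ _
  rwa [IsSelfAdjoint.star_eq (((hT.commute_iff hT).mp (Commute.refl T)).sub hT)]

theorem isSelfAdjoint_nearProjection {T : C} (hT : IsSelfAdjoint T) :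
    IsSelfAdjoint (nearProjection T) := by
  have h1 : IsSelfAdjoint (algebraMap ℝ C (1 / 2)) := .algebraMap C (.all _)
  exact h1.add (((hT.sub h1).commute_iff (cfc_predicate _ _)).mp
    (commute_cfc_mul_self_sub_self hT).symm)

theorem nearProjection_mul_self_sub {T : C} (hT : IsSelfAdjoint T) :
    nearProjection T * nearProjection T - nearProjection T =
      cfc (fun u => (u + 1 / 4) * (invSqrt u * invSqrt u) - 1 / 4) (T * T - T) := by
  have hsa : IsSelfAdjoint (T * T - T) := ((hT.commute_iff hT).mp (Commute.refl T)).sub hT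
  have hc := continuous_invSqrt
  have hcomm := (commute_cfc_mul_self_sub_self hT).eq
  rw [cfc_sub _ _ _ (by fun_prop) (by fun_prop), cfc_const _ _ hsa,
    cfc_mul _ _ _ (by fun_prop) (by fun_prop),
    cfc_add_const _ _ _ (by fun_prop), cfc_id' ℝ (T * T - T),
    cfc_mul _ _ _ (by fun_prop) (by fun_prop), nearProjection]
  set R := cfc invSqrt (T * T - T)
  set S := T - algebraMap ℝ C (1 / 2) with hS
  have hSS : T * T - T + algebraMap ℝ C (1 / 4) = S * S := by
    simp only [hS, Algebra.algebraMap_eq_smul_one, sub_mul, mul_sub, smul_mul_assoc, mul_smul_comm,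
      one_mul, mul_one]
    module
  have hSR : S * R * (S * R) = S * S * (R * R) := by
    rw [mul_assoc, ← mul_assoc R, hcomm]; noncomm_ring
  rw [hSS, ← hSR]
  simp only [Algebra.algebraMap_eq_smul_one, add_mul, mul_add, smul_mul_assoc, mul_smul_comm,
      one_mul, mul_one]
  module

theorem cfc_invSqrt_sub_one_mem {T : C} (hT : IsSelfAdjoint T) {W : Submodule ℝ C}
    (hW : IsClosed (W : Set C)) (hTW : T * T - T ∈ W) (hmul : ∀ w ∈ W, (T * T - T) * w ∈ W) :
    cfc invSqrt (T * T - T) - 1 ∈ W := by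
  have hsa : IsSelfAdjoint (T * T - T) := ((hT.commute_iff hT).mp (Commute.refl T)).sub hT
  simpa [cfc_apply_zero] using cfc_sub_cfc_mem W hW hsa (IsSelfAdjoint.zero C) (by simpa using hTW)
    hmul (by simp) continuous_invSqrt

theorem nearProjection_mul_self_sub_mem {T : C} (hT : IsSelfAdjoint T) {W : Submodule ℝ C}
    (hW : IsClosed (W : Set C)) (hl : ∀ a, ∀ w ∈ W, a * w ∈ W) (hr : ∀ a, ∀ w ∈ W, w * a ∈ W)
    {s : C} (hs : IsSelfAdjoint s) (hsW : s ∈ W) (hnorm : ‖T * T - T - s‖ ≤ 3 / 16) :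
    nearProjection T * nearProjection T - nearProjection T ∈ W := by
  nontriviality C
  have hsa : IsSelfAdjoint (T * T - T) := ((hT.commute_iff hT).mp (Commute.refl T)).sub hT
  have hc := continuous_invSqrt
  have h0 : cfc (fun u => (u + 1 / 4) * (invSqrt u * invSqrt u) - 1 / 4) (T * T - T - s) = 0 := by
    rw [← cfc_const_zero ℝ (T * T - T - s)]
    refine cfc_congr fun u hu => invSqrt_mul_self ?_
    exact (abs_le.mp ((spectrum.norm_le_norm_of_mem hu).trans hnorm)).1
  have h1 := cfc_sub_cfc_mem W hW hsa (hsa.sub hs) (by simpa using hsW) (hl _) (hr _)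
    (f := fun u => (u + 1 / 4) * (invSqrt u * invSqrt u) - 1 / 4) (by fun_prop)
  rwa [h0, sub_zero, ← nearProjection_mul_self_sub hT] at h1

end Perturbation

section Unital

variable {B : Type*} [CStarAlgebra B]

namespace TwoByTwo

/-- The matrices with entries in a given ideal. -/
noncomputable def ideal (J : Ideal B) : Submodule ℝ (TwoByTwo B) :=
  submodule fun _ _ => J.restrictScalars ℝ

theorem mem_ideal {J : Ideal B} {M : TwoByTwo B} : M ∈ ideal J ↔ ∀ i j, M.entry i j ∈ J := Iff.rfl

theorem isClosed_ideal {J : Ideal B} (hJ : IsClosed (J : Set B)) :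
    IsClosed (ideal J : Set (TwoByTwo B)) :=
  isClosed_submodule fun _ _ => hJ

theorem mul_mem_ideal_left {J : Ideal B} (a w : TwoByTwo B) (hw : w ∈ ideal J) :
    a * w ∈ ideal J := fun i j => by
  rw [entry_mul]
  exact J.add_mem (J.mul_mem_left _ (hw _ _)) (J.mul_mem_left _ (hw _ _))

theorem mul_mem_ideal_right {J : Ideal B} [J.IsTwoSided] (a w : TwoByTwo B) (hw : w ∈ ideal J) :
    w * a ∈ ideal J := fun i j => by
  rw [entry_mul]
  exact J.add_mem (J.mul_mem_right _ (hw _ _)) (J.mul_mem_right _ (hw _ _))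

/-- A matrix with entries in the closure of an increasing union of closed ideals is a limit of
self-adjoint matrices with entries in the ideals, if it is self-adjoint. -/
theorem exists_norm_sub_le {I : ℕ → Ideal B} [∀ n, (I n).IsTwoSided]
    (hclosed : ∀ n, IsClosed (I n : Set B)) (hmono : Monotone I) {M : TwoByTwo B}
    (hM : IsSelfAdjoint M) (hmem : ∀ i j, M.entry i j ∈ closure (⋃ n, (I n : Set B)))
    {ε : ℝ} (hε : 0 < ε) : ∃ n, ∃ s ∈ ideal (I n), IsSelfAdjoint s ∧ ‖M - s‖ ≤ ε := by
  choose u hu hlim using fun i j => mem_closure_iff_seq_limit.mp (hmem i j)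
  have hT : Tendsto (fun m => of fun i j => u i j m) atTop (𝓝 M) := tendsto_of_entry hlim
  obtain ⟨m, hm⟩ := (hT.eventually (Metric.ball_mem_nhds M hε)).exists
  set t : TwoByTwo B := of fun i j => u i j m
  have hmt : ‖M - t‖ ≤ ε := by
    rw [dist_comm, dist_eq_norm] at hm
    exact hm.le
  choose N hN using fun i j => Set.mem_iUnion.mp (hu i j m)
  obtain ⟨n, hn⟩ : ∃ n, ∀ i j, N i j ≤ n :=
    ⟨Finset.univ.sup fun p : Fin 2 × Fin 2 => N p.1 p.2, fun i j =>
      Finset.le_sup (f := fun p : Fin 2 × Fin 2 => N p.1 p.2) (Finset.mem_univ (i, j))⟩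
  have ht : t ∈ ideal (I n) := fun i j => hmono (hn i j) (hN i j)
  have hst : star t ∈ ideal (I n) := fun i j => star_mem_ideal (I n) (hclosed n) (ht j i)
  refine ⟨n, (1 / 2 : ℝ) • (t + star t), Submodule.smul_mem _ _ (Submodule.add_mem _ ht hst),
    IsSelfAdjoint.smul (.all _) (.add_star_self t), ?_⟩
  have hdec : M - (1 / 2 : ℝ) • (t + star t) = (1 / 2 : ℝ) • ((M - t) + star (M - t)) := by
    rw [star_sub, hM.star_eq]
    module
  rw [hdec, norm_smul]
  have := norm_add_le (M - t) (star (M - t))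
  rw [norm_star] at this
  rw [Real.norm_of_nonneg (by norm_num)]
  linarith

/-- The elements killed by `L` from the left and by `R` from the right. -/
def annihilated (L R : Set B) : Submodule ℝ B where
  carrier := {a | (∀ l ∈ L, l * a = 0) ∧ ∀ r ∈ R, a * r = 0}
  add_mem' ha hb := ⟨fun l hl => by rw [mul_add, ha.1 l hl, hb.1 l hl, add_zero],
    fun r hr => by rw [add_mul, ha.2 r hr, hb.2 r hr, add_zero]⟩
  zero_mem' := ⟨fun l _ => mul_zero l, fun r _ => zero_mul r⟩
  smul_mem' c a ha := ⟨fun l hl => by rw [mul_smul_comm, ha.1 l hl, smul_zero],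
    fun r hr => by rw [smul_mul_assoc, ha.2 r hr, smul_zero]⟩

theorem mem_annihilated {L R : Set B} {a : B} :
    a ∈ annihilated L R ↔ (∀ l ∈ L, l * a = 0) ∧ ∀ r ∈ R, a * r = 0 := Iff.rfl

theorem isClosed_annihilated (L R : Set B) : IsClosed (annihilated L R : Set B) := by
  have : (annihilated L R : Set B) =
      (⋂ l ∈ L, {a | l * a = 0}) ∩ ⋂ r ∈ R, {a | a * r = 0} := by
    ext; simp [mem_annihilated]
  rw [this]
  exact (isClosed_biInter fun l _ => isClosed_eq (continuous_const_mul l) continuous_const).inter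
    (isClosed_biInter fun r _ => isClosed_eq (continuous_mul_const r) continuous_const)

/-- The sets whose annihilators describe the corners associated with `k`: the complementary corner
has index `0` and the corner generated by `k` has index `1`. -/
def cornerSet (k : B) : Fin 2 → Set B := ![{k}, {n | n * k = 0 ∧ k * n = 0}]

/-- The matrices of elements supported in the corners associated with `k`. -/
def corners (k : B) : Submodule ℝ (TwoByTwo B) :=
  submodule fun i j => annihilated (cornerSet k i) (cornerSet k j)

theorem isClosed_corners (k : B) : IsClosed (corners k : Set (TwoByTwo B)) :=
  isClosed_submodule fun _ _ => isClosed_annihilated _ _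

theorem mul_mem_corners {k : B} {M N : TwoByTwo B} (hM : M ∈ corners k) (hN : N ∈ corners k) :
    M * N ∈ corners k := fun i j => by
  refine ⟨fun l hl => ?_, fun r hr => ?_⟩
  · rw [entry_mul, mul_add, ← mul_assoc, ← mul_assoc, (hM i 0).1 l hl, (hM i 1).1 l hl]
    simp
  · rw [entry_mul, add_mul, mul_assoc, mul_assoc, (hN 0 j).2 r hr, (hN 1 j).2 r hr]
    simp

/-- The diagonal matrix unit with index `0`. -/
def unitZero : TwoByTwo B := of ![![1, 0], ![0, 0]]

theorem unitZero_mul_mem_corners {k : B} {M : TwoByTwo B} (hM : M ∈ corners k) :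
    unitZero * M ∈ corners k := fun i j => by
  fin_cases i
  · simpa [unitZero] using hM 0 j
  · simp [unitZero]

theorem mul_unitZero_mem_corners {k : B} {M : TwoByTwo B} (hM : M ∈ corners k) :
    M * unitZero ∈ corners k := fun i j => by
  fin_cases j
  · simpa [unitZero] using hM i 0
  · simp [unitZero]

theorem unitZero_mul_self : (unitZero : TwoByTwo B) * unitZero = unitZero := by
  refine ext_entry fun i j => ?_
  fin_cases i <;> fin_cases j <;> simp [unitZero]

theorem entry_mul_entry_eq_zero {k : B} {M : TwoByTwo B} (hM : M ∈ corners k) :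
    M.entry 0 0 * M.entry 1 1 = 0 :=
  (hM 1 1).1 _ ⟨(hM 0 0).2 k rfl, (hM 0 0).1 k rfl⟩

theorem nearProjection_sub_unitZero_mem_corners {k : B} {T : TwoByTwo B} (hT : IsSelfAdjoint T)
    (hTk : T - unitZero ∈ corners k) : nearProjection T - unitZero ∈ corners k := by
  have hl : ∀ w ∈ corners k, T * w ∈ corners k := fun w hw => by
    have := Submodule.add_mem _ (mul_mem_corners hTk hw) (unitZero_mul_mem_corners hw)
    rwa [← add_mul, sub_add_cancel] at this
  have hC : T * T - T ∈ corners k := by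
    have h1 : T * T - T = T * (T - unitZero) + (T - unitZero) * unitZero - (T - unitZero) := by
      rw [sub_mul, unitZero_mul_self]; noncomm_ring
    rw [h1]
    exact Submodule.sub_mem _ (Submodule.add_mem _ (hl _ hTk) (mul_unitZero_mem_corners hTk)) hTk
  have hR := cfc_invSqrt_sub_one_mem hT (isClosed_corners k) hC fun w hw => mul_mem_corners hC hw
  rw [← sub_add_sub_cancel _ T, nearProjection_sub_self, sub_mul, Algebra.algebraMap_eq_smul_one,
    smul_one_mul]
  exact Submodule.add_mem _
    (Submodule.sub_mem _ (hl _ hR) (Submodule.smul_mem _ _ hR)) hTk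

/-- The matrix attached to a triple; it is a projection exactly when the triple satisfies the
relations of `qℂ` other than orthogonality. -/
def ofTriple (h x k : B) : TwoByTwo B := of ![![1 - h, star x], ![x, k]]

theorem isSelfAdjoint_ofTriple {h k : B} (x : B) (hsa : IsSelfAdjoint h) (ksa : IsSelfAdjoint k) :
    IsSelfAdjoint (ofTriple h x k) := by
  refine ext_entry fun i j => ?_
  fin_cases i <;> fin_cases j <;> simp [ofTriple, hsa.star_eq, ksa.star_eq]

theorem ofTriple_mul_self_sub_mem_ideal {J : Ideal B} [J.IsTwoSided] (hJ : IsClosed (J : Set B))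
    {h x k : B} (hsa : IsSelfAdjoint h) (ksa : IsSelfAdjoint k)
    (rel2 : h * h + star x * x - h ∈ J) (rel3 : k * k + x * star x - k ∈ J)
    (rel4 : k * x - x * h ∈ J) :
    ofTriple h x k * ofTriple h x k - ofTriple h x k ∈ ideal J := by
  have rel4' := star_mem_ideal J hJ rel4
  simp only [star_sub, star_mul, hsa.star_eq, ksa.star_eq] at rel4'
  intro i j
  fin_cases i <;> fin_cases j
  · convert rel2 using 1
    simp [ofTriple]; noncomm_ring
  · convert rel4' using 1
    simp [ofTriple]; noncomm_ring
  · convert rel4 using 1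
    simp [ofTriple]; noncomm_ring
  · convert rel3 using 1
    simp [ofTriple]; noncomm_ring

theorem ofTriple_sub_unitZero_mem_corners {h x k : B} (ksa : IsSelfAdjoint k)
    (hk : h * k = 0) (kh : k * h = 0) (hxk : x * k = 0)
    (hkx : ∀ n, n * k = 0 → n * x = 0) : ofTriple h x k - unitZero ∈ corners k := by
  have hkx' : k * star x = 0 := by rw [← ksa.star_eq, ← star_mul, hxk, star_zero]
  have hkx'' : ∀ n, k * n = 0 → star x * n = 0 := fun n hn => by
    rw [← star_star n, ← star_mul, hkx, star_zero]
    rw [← ksa.star_eq, ← star_mul, hn, star_zero]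
  intro i j
  fin_cases i <;> fin_cases j
  · simp [ofTriple, unitZero, cornerSet, mem_annihilated, hk, kh]
  · simpa [ofTriple, unitZero, cornerSet, mem_annihilated, hkx'] using fun n _ => hkx'' n
  · simpa [ofTriple, unitZero, cornerSet, mem_annihilated, hxk] using fun n hn _ => hkx n hn
  · simp +contextual [ofTriple, unitZero, cornerSet, mem_annihilated]

end TwoByTwo

/-- Elements satisfying the relations of `qℂ` modulo a closed ideal are congruent to elements that
also satisfy the orthogonality relations of `qℂ` exactly. -/
theorem exists_orthogonal_lift_s12 (J : Ideal B) [J.IsTwoSided] (hJ : IsClosed (J : Set B))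
    {h x k : B} (hsa : IsSelfAdjoint h) (ksa : IsSelfAdjoint k) (rel1 : h * k ∈ J)
    (rel2 : h * h + star x * x - h ∈ J) (rel3 : k * k + x * star x - k ∈ J) :
    ∃ h' x' k' : B, IsSelfAdjoint h' ∧ IsSelfAdjoint k' ∧ h' * k' = 0 ∧ x' * k' = 0 ∧
      (∀ n, n * k' = 0 → n * x' = 0) ∧ h - h' ∈ J ∧ x - x' ∈ J ∧ k - k' ∈ J := by
  let := CStarAlgebra.spectralOrder B
  let := CStarAlgebra.spectralOrderedRing B
  have hpos : 0 ≤ h * h + star x * x := by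
    have := star_mul_self_nonneg h
    rw [hsa.star_eq] at this
    exact add_nonneg this (star_mul_self_nonneg x)
  have kpos : 0 ≤ k * k + x * star x := by
    have := star_mul_self_nonneg k
    rw [ksa.star_eq] at this
    exact add_nonneg this (mul_star_self_nonneg x)
  have congr_mul : ∀ {a a' b b' : B}, a - a' ∈ J → b - b' ∈ J → a * b - a' * b' ∈ J := by
    intro a a' b b' ha hb
    have : a * b - a' * b' = a * (b - b') + (a - a') * b' := by noncomm_ring
    rw [this]
    exact J.add_mem (J.mul_mem_left _ hb) (J.mul_mem_right _ ha)
  have rel1' : (h * h + star x * x) * (k * k + x * star x) ∈ J := by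
    simpa using J.add_mem (congr_mul rel2 rel3) rel1
  obtain ⟨h', k', hsa', ksa', hk', hh', kk'⟩ := exists_mul_eq_zero_of_mul_mem J hJ hpos kpos rel1'
  have hh : h - h' ∈ J := by simpa using J.sub_mem hh' rel2
  have kk : k - k' ∈ J := by simpa using J.sub_mem kk' rel3
  have hc := continuous_fifthRoot
  have h2sa : IsSelfAdjoint (h' - h' * h') :=
    hsa'.sub ((hsa'.commute_iff hsa').mp (Commute.refl h'))
  have k2sa : IsSelfAdjoint (k' - k' * k') :=
    ksa'.sub ((ksa'.commute_iff ksa').mp (Commute.refl k'))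
  obtain ⟨v, hv⟩ := exists_eq_cfc_fifthRoot_mul x
  have hp : cfc fifthRoot (x * star x) - cfc fifthRoot (k' - k' * k') ∈ J := by
    refine cfc_sub_cfc_mem_ideal J hJ (.mul_star_self x) k2sa ?_ hc
    convert J.add_mem rel3 (J.sub_mem kk (congr_mul kk kk)) using 1
    noncomm_ring
  have hq : cfc fifthRoot (star x * x) - cfc fifthRoot (h' - h' * h') ∈ J := by
    refine cfc_sub_cfc_mem_ideal J hJ (.star_mul_self x) h2sa ?_ hc
    convert J.add_mem rel2 (J.sub_mem hh (congr_mul hh hh)) using 1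
    noncomm_ring
  refine ⟨h', cfc fifthRoot (k' - k' * k') * v * cfc fifthRoot (h' - h' * h'), k', hsa', ksa', hk',
    ?_, fun n hn => ?_, hh, ?_, kk⟩
  · rw [mul_assoc, cfc_mul_eq_zero h2sa _ hc fifthRoot_zero, mul_zero]
    rw [sub_mul, mul_assoc, hk', mul_zero, sub_zero]
  · rw [← mul_assoc, ← mul_assoc, mul_cfc_eq_zero k2sa _ hc fifthRoot_zero, zero_mul, zero_mul]
    rw [mul_sub, ← mul_assoc, hn, zero_mul, sub_zero]
  · conv in x - _ => rw [hv]
    exact congr_mul (congr_mul hp (by simp)) hq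

open TwoByTwo in
/-- Semiprojectivity of `qℂ` for unital C⋆-algebras. -/
theorem exists_lift_of_unital (I : ℕ → Ideal B) [∀ n, (I n).IsTwoSided]
    (hclosed : ∀ n, IsClosed (I n : Set B)) (hmono : Monotone I) (J : Ideal B) [J.IsTwoSided]
    (hJ : (J : Set B) = closure (⋃ n, (I n : Set B)))
    {h x k : B} (hsa : IsSelfAdjoint h) (ksa : IsSelfAdjoint k) (rel1 : h * k ∈ J)
    (rel2 : h * h + star x * x - h ∈ J) (rel3 : k * k + x * star x - k ∈ J)
    (rel4 : k * x - x * h ∈ J) :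
    ∃ (n : ℕ) (h' x' k' : B), IsSelfAdjoint h' ∧ IsSelfAdjoint k' ∧
      h' * k' ∈ I n ∧
      h' * h' + star x' * x' - h' ∈ I n ∧
      k' * k' + x' * star x' - k' ∈ I n ∧
      k' * x' - x' * h' ∈ I n ∧
      h - h' ∈ J ∧ x - x' ∈ J ∧ k - k' ∈ J := by
  have hJc : IsClosed (J : Set B) := hJ ▸ isClosed_closure
  obtain ⟨h₁, x₁, k₁, hsa₁, ksa₁, hk₁, xk₁, kx₁, hh, hx, hk⟩ :=
    exists_orthogonal_lift_s12 J hJc hsa ksa rel1 rel2 rel3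
  have kh₁ : k₁ * h₁ = 0 := by
    rw [← hsa₁.star_eq, ← ksa₁.star_eq, ← star_mul, hk₁, star_zero]
  set T := ofTriple h x k with hT
  set T₁ := ofTriple h₁ x₁ k₁ with hT₁
  have Tsa₁ : IsSelfAdjoint T₁ := isSelfAdjoint_ofTriple x₁ hsa₁ ksa₁
  have hTT₁ : T - T₁ ∈ ideal J := by
    intro i j
    fin_cases i <;> fin_cases j
    · simpa [hT, hT₁, ofTriple] using J.neg_mem hh
    · simpa [hT, hT₁, ofTriple] using star_mem_ideal J hJc hx
    · simpa [hT, hT₁, ofTriple] using hx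
    · simpa [hT, hT₁, ofTriple] using hk
  have hC₁ : T₁ * T₁ - T₁ ∈ ideal J := by
    have h1 : T₁ * T₁ - T₁ =
        (T * T - T) - (T * (T - T₁) + (T - T₁) * T₁) + (T - T₁) := by noncomm_ring
    rw [h1]
    exact Submodule.add_mem _ (Submodule.sub_mem _
      (ofTriple_mul_self_sub_mem_ideal hJc hsa ksa rel2 rel3 rel4)
      (Submodule.add_mem _ (mul_mem_ideal_left _ _ hTT₁) (mul_mem_ideal_right _ _ hTT₁))) hTT₁
  have Csa₁ : IsSelfAdjoint (T₁ * T₁ - T₁) :=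
    ((Tsa₁.commute_iff Tsa₁).mp (Commute.refl T₁)).sub Tsa₁
  obtain ⟨n, s, hs, ssa, hnorm⟩ := exists_norm_sub_le hclosed hmono Csa₁
    (fun i j => hJ ▸ hC₁ i j) (ε := 3 / 16) (by norm_num)
  set P := nearProjection T₁ with hP
  have Psa : IsSelfAdjoint P := isSelfAdjoint_nearProjection Tsa₁
  have hPP : P * P - P ∈ ideal (I n) := nearProjection_mul_self_sub_mem Tsa₁
    (isClosed_ideal (hclosed n)) mul_mem_ideal_left mul_mem_ideal_right ssa hs hnorm
  have hPT : P - T ∈ ideal J := by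
    rw [← sub_add_sub_cancel P T₁ T, hP, nearProjection_sub_self, ← neg_sub T T₁]
    exact Submodule.add_mem _ (mul_mem_ideal_left _ _ (cfc_invSqrt_sub_one_mem Tsa₁
      (isClosed_ideal hJc) hC₁ (mul_mem_ideal_left _))) (Submodule.neg_mem _ hTT₁)
  have hcor : P - unitZero ∈ corners k₁ := nearProjection_sub_unitZero_mem_corners Tsa₁
    (ofTriple_sub_unitZero_mem_corners ksa₁ hk₁ kh₁ xk₁ kx₁)
  have hP00 : star (P.entry 0 0) = P.entry 0 0 := congrArg (fun M => entry M 0 0) Psa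
  have hP01 : P.entry 0 1 = star (P.entry 1 0) := (congrArg (fun M => entry M 0 1) Psa).symm
  have hP11 : star (P.entry 1 1) = P.entry 1 1 := congrArg (fun M => entry M 1 1) Psa
  refine ⟨n, 1 - P.entry 0 0, P.entry 1 0, P.entry 1 1, (IsSelfAdjoint.one B).sub hP00, hP11,
    ?_, ?_, ?_, ?_, ?_, ?_, ?_⟩
  · have h1 := entry_mul_entry_eq_zero hcor
    simp only [unitZero, entry_sub, entry_of] at h1
    have h2 : (1 - P.entry 0 0) * P.entry 1 1 = 0 := by
      rw [← neg_sub, neg_mul, neg_eq_zero]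
      simpa using h1
    rw [h2]
    exact (I n).zero_mem
  · convert mem_ideal.mp hPP 0 0 using 1
    rw [entry_sub, entry_mul, hP01]; noncomm_ring
  · convert mem_ideal.mp hPP 1 1 using 1
    rw [entry_sub, entry_mul, hP01]; noncomm_ring
  · convert mem_ideal.mp hPP 1 0 using 1
    rw [entry_sub, entry_mul]; noncomm_ring
  · convert mem_ideal.mp hPT 0 0 using 1
    simp [hT, ofTriple]; noncomm_ring
  · convert J.neg_mem (mem_ideal.mp hPT 1 0) using 1
    simp [hT, ofTriple]
  · convert J.neg_mem (mem_ideal.mp hPT 1 1) using 1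
    simp [hT, ofTriple]

end Unital

section Nonunital

variable {A : Type*} [NonUnitalCStarAlgebra A]

namespace TwoSidedIdeal

theorem smul_mem_of_isClosed (K : TwoSidedIdeal A) (hK : IsClosed (K : Set A)) (c : ℂ) {a : A}
    (ha : a ∈ K) : c • a ∈ K := by
  let := CStarAlgebra.spectralOrder A
  let := CStarAlgebra.spectralOrderedRing A
  have hlim := ((CStarAlgebra.increasingApproximateUnit A).tendsto_mul_right a).const_smul c
  refine hK.mem_of_tendsto hlim (Eventually.of_forall fun e => ?_)
  rw [← smul_mul_assoc]
  exact K.mul_mem_left _ _ ha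

/-- A closed ideal of a C⋆-algebra as an ideal of the unitization. -/
def toUnitization (K : TwoSidedIdeal A) (hK : IsClosed (K : Set A)) : Ideal (Unitization ℂ A) where
  carrier := (fun a : A => (a : Unitization ℂ A)) '' K
  add_mem' := by
    rintro _ _ ⟨a, ha, rfl⟩ ⟨b, hb, rfl⟩
    exact ⟨a + b, K.add_mem ha hb, Unitization.inr_add ℂ a b⟩
  zero_mem' := ⟨0, K.zero_mem, Unitization.inr_zero ℂ⟩
  smul_mem' := by
    rintro b _ ⟨a, ha, rfl⟩
    refine ⟨b.fst • a + b.snd * a,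
      K.add_mem (K.smul_mem_of_isClosed hK _ ha) (K.mul_mem_left _ _ ha), ?_⟩
    ext <;> simp

theorem coe_toUnitization (K : TwoSidedIdeal A) (hK : IsClosed (K : Set A)) :
    (K.toUnitization hK : Set (Unitization ℂ A)) = (fun a : A => (a : Unitization ℂ A)) '' K := rfl

theorem inr_mem_toUnitization {K : TwoSidedIdeal A} {hK : IsClosed (K : Set A)} {a : A} :
    (a : Unitization ℂ A) ∈ K.toUnitization hK ↔ a ∈ K :=
  Unitization.inr_injective.mem_set_image

theorem exists_inr_eq_of_mem_toUnitization {K : TwoSidedIdeal A} {hK : IsClosed (K : Set A)}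
    {b : Unitization ℂ A} (hb : b ∈ K.toUnitization hK) : ∃ a : A, (a : Unitization ℂ A) = b :=
  let ⟨a, _, hab⟩ := hb
  ⟨a, hab⟩

instance (K : TwoSidedIdeal A) (hK : IsClosed (K : Set A)) : (K.toUnitization hK).IsTwoSided where
  mul_mem_of_left := by
    rintro _ b ⟨a, ha, rfl⟩
    refine ⟨b.fst • a + a * b.snd,
      K.add_mem (K.smul_mem_of_isClosed hK _ ha) (K.mul_mem_right _ _ ha), ?_⟩
    ext <;> simp

theorem isClosedEmbedding_inr :
    IsClosedEmbedding fun a : A => (a : Unitization ℂ A) :=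
  (Unitization.isometry_inr (𝕜 := ℂ)).isClosedEmbedding

theorem isClosed_toUnitization (K : TwoSidedIdeal A) (hK : IsClosed (K : Set A)) :
    IsClosed (K.toUnitization hK : Set (Unitization ℂ A)) :=
  isClosedEmbedding_inr.isClosedMap _ hK

theorem toUnitization_mono {K L : TwoSidedIdeal A} (hK : IsClosed (K : Set A))
    (hL : IsClosed (L : Set A)) (h : K ≤ L) : K.toUnitization hK ≤ L.toUnitization hL :=
  Set.image_mono h

/-- The closure of the union of an increasing sequence of ideals. -/
def closureUnion (I : ℕ → TwoSidedIdeal A) (hmono : Monotone I) : TwoSidedIdeal A :=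
  .mk' (closure (⋃ n, (I n : Set A)))
    (subset_closure (Set.mem_iUnion.mpr ⟨0, (I 0).zero_mem⟩))
    (fun hx hy => map_mem_closure₂ continuous_add hx hy fun a ha b hb => by
      obtain ⟨m, hm⟩ := Set.mem_iUnion.mp ha
      obtain ⟨n, hn⟩ := Set.mem_iUnion.mp hb
      exact Set.mem_iUnion.mpr ⟨max m n, (I _).add_mem (hmono (le_max_left m n) hm)
        (hmono (le_max_right m n) hn)⟩)
    (fun hx => map_mem_closure continuous_neg hx fun a ha => by
      obtain ⟨m, hm⟩ := Set.mem_iUnion.mp ha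
      exact Set.mem_iUnion.mpr ⟨m, (I m).neg_mem hm⟩)
    (fun {b} _ hx => map_mem_closure (continuous_const_mul b) hx fun a ha => by
      obtain ⟨m, hm⟩ := Set.mem_iUnion.mp ha
      exact Set.mem_iUnion.mpr ⟨m, (I m).mul_mem_left _ _ hm⟩)
    (fun {_ b} hx => map_mem_closure (f := fun a => a * b) (continuous_mul_const b) hx
        fun a ha => by
      obtain ⟨m, hm⟩ := Set.mem_iUnion.mp ha
      exact Set.mem_iUnion.mpr ⟨m, (I m).mul_mem_right _ _ hm⟩)

theorem coe_closureUnion (I : ℕ → TwoSidedIdeal A) (hmono : Monotone I) :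
    (closureUnion I hmono : Set A) = closure (⋃ n, (I n : Set A)) :=
  TwoSidedIdeal.coe_mk' _ _ _ _ _ _

theorem mem_closureUnion {I : ℕ → TwoSidedIdeal A} {hmono : Monotone I} {a : A} :
    a ∈ closureUnion I hmono ↔ a ∈ closure (⋃ n, (I n : Set A)) := by
  rw [← coe_closureUnion I hmono, SetLike.mem_coe]

end TwoSidedIdeal

end Nonunital


/-- semiprojectivity of `qℂ`. Let `I₁ ⊆ I₂ ⊆ ⋯` be an increasing sequence of
closed two-sided ideals of a C*-algebra `A`, and let `I` be the closure of their union. If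
self-adjoint `h, k` and `x` in `A` satisfy the `qℂ` relations modulo `I`, then there are `n ∈ ℕ`
and self-adjoint `h', k'` and `x'` in `A`, congruent to `h, k, x` modulo `I`, satisfying the
`qℂ` relations modulo `Iₙ`. -/
theorem stmt12 {A : Type*} [NonUnitalCStarAlgebra A]
    (I : ℕ → TwoSidedIdeal A) (hclosed : ∀ n, IsClosed (I n : Set A))
    (hmono : Monotone I)
    (h x k : A) (hsa : IsSelfAdjoint h) (ksa : IsSelfAdjoint k)
    (rel1 : h * k ∈ closure (⋃ n, (I n : Set A)))
    (rel2 : h * h + star x * x - h ∈ closure (⋃ n, (I n : Set A)))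
    (rel3 : k * k + x * star x - k ∈ closure (⋃ n, (I n : Set A)))
    (rel4 : k * x - x * h ∈ closure (⋃ n, (I n : Set A))) :
    ∃ (n : ℕ) (h' x' k' : A), IsSelfAdjoint h' ∧ IsSelfAdjoint k' ∧
      h' * k' ∈ I n ∧
      h' * h' + star x' * x' - h' ∈ I n ∧
      k' * k' + x' * star x' - k' ∈ I n ∧
      k' * x' - x' * h' ∈ I n ∧
      h - h' ∈ closure (⋃ m, (I m : Set A)) ∧
      x - x' ∈ closure (⋃ m, (I m : Set A)) ∧
      k - k' ∈ closure (⋃ m, (I m : Set A)) := by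
  have hJ : IsClosed (TwoSidedIdeal.closureUnion I hmono : Set A) :=
    TwoSidedIdeal.coe_closureUnion I hmono ▸ isClosed_closure
  have hcl : ((TwoSidedIdeal.closureUnion I hmono).toUnitization hJ : Set (Unitization ℂ A)) =
      closure (⋃ n, ((I n).toUnitization (hclosed n) : Set (Unitization ℂ A))) := by
    simp only [TwoSidedIdeal.coe_toUnitization, ← Set.image_iUnion]
    rw [TwoSidedIdeal.isClosedEmbedding_inr.closure_image_eq, TwoSidedIdeal.coe_closureUnion]
  simp only [← TwoSidedIdeal.mem_closureUnion (hmono := hmono),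
    ← TwoSidedIdeal.inr_mem_toUnitization (hK := hJ)] at rel1 rel2 rel3 rel4 ⊢
  simp only [Unitization.inr_add, Unitization.inr_sub, Unitization.inr_mul, Unitization.inr_star]
    at rel1 rel2 rel3 rel4
  obtain ⟨n, h', x', k', hsa', ksa', hrel1, hrel2, hrel3, hrel4, hh, hx, hk⟩ :=
    exists_lift_of_unital (fun n => (I n).toUnitization (hclosed n))
      (fun n => (I n).isClosed_toUnitization (hclosed n))
      (fun _ _ hmn => TwoSidedIdeal.toUnitization_mono _ _ (hmono hmn))
      _ hcl (hsa.inr ℂ) (ksa.inr ℂ) rel1 rel2 rel3 rel4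
  have lift : ∀ {a : A} {b : Unitization ℂ A},
      (a : Unitization ℂ A) - b ∈ (TwoSidedIdeal.closureUnion I hmono).toUnitization hJ →
      ∃ a' : A, (a' : Unitization ℂ A) = b := fun {a b} hb => by
    obtain ⟨c, hc⟩ := TwoSidedIdeal.exists_inr_eq_of_mem_toUnitization hb
    exact ⟨a - c, by rw [Unitization.inr_sub, hc, sub_sub_cancel]⟩
  obtain ⟨h', rfl⟩ := lift hh
  obtain ⟨x', rfl⟩ := lift hx
  obtain ⟨k', rfl⟩ := lift hk
  simp only [← Unitization.inr_add, ← Unitization.inr_sub, ← Unitization.inr_mul,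
    ← Unitization.inr_star, TwoSidedIdeal.inr_mem_toUnitization] at hrel1 hrel2 hrel3 hrel4
  refine ⟨n, h', x', k', ?_, ?_, hrel1, hrel2, hrel3, hrel4, ?_, ?_, ?_⟩
  · exact Unitization.inr_injective ((Unitization.inr_star h').trans hsa')
  · exact Unitization.inr_injective ((Unitization.inr_star k').trans ksa')
  · rwa [Unitization.inr_sub]
  · rwa [Unitization.inr_sub]
  · rwa [Unitization.inr_sub]
end
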